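/- There is no algorithm (partial recursive function on codes) that, on input of a code of a finite presentation P = (m, R) whose presented group has a nontrivial torsion element, together with a natural number n ≥ 2 such that the presented group of P contains an element of order exactly n, halts and outputs a code of a word w : List (Fin m × Bool) whose image in the presented group of P is a nontrivial torsion element (an element g with g ≠ 1 and of finite order, i.e. orderOf g ≥ 2), not necessarily of order n. -/

import Mathlib

/-- A word in `m` generators. -/
abbrev Word (m : ℕ) : Type := List (Fin m × Bool)

/-- A finite presentation: a number of generators together with a finite list of relator words. -/
abbrev FinPres : Type := Σ m : ℕ, List (Word m)

/-- The set of relators of a finite presentation, as elements of the free group. -/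
def FinPres.rels (P : FinPres) : Set (FreeGroup (Fin P.1)) :=
  {x | ∃ r ∈ P.2, x = FreeGroup.mk r}

/-- The group presented by a finite presentation. -/
abbrev FinPres.Grp (P : FinPres) : Type := PresentedGroup P.rels

/-- The projection from the free group onto the presented group. -/
def FinPres.proj (P : FinPres) : FreeGroup (Fin P.1) →* P.Grp :=
  PresentedGroup.mk P.rels

/-- The `n`-th recursively enumerable set: the domain of the `n`-th partial recursive
function under the canonical numbering. -/
def W (n : ℕ) : Set ℕ := {x | ((Denumerable.ofNat Nat.Partrec.Code n).eval x).Dom}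

/-- The set of orders of nontrivial torsion elements of a group. -/
def TorOrd (G : Type*) [Group G] : Set ℕ := {n | 2 ≤ n ∧ ∃ g : G, orderOf g = n}

section PermutationModel

/-- A surjection becomes, after multiplying by a type absorbing the source, a projection. -/
theorem exists_equiv_prod_of_surjective {Ω Y X : Type} {π : Ω → Y} (hπ : Function.Surjective π)
    {f : Ω × X → X} (hf : Function.Injective f) :
    ∃ e : Ω × X ≃ Y × X, ∀ z, (e z).1 = π z.1 := by
  have key : ∀ y, Nonempty ({ω // π ω = y} × X ≃ X) := by
    intro y
    obtain ⟨ω, hω⟩ := hπ y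
    have h1 : Function.Injective (fun z : {ω // π ω = y} × X => f (z.1.1, z.2)) := by
      rintro ⟨⟨a, ha⟩, b⟩ ⟨⟨a', ha'⟩, b'⟩ h
      simpa using hf h
    have h2 : Function.Injective (fun x : X => ((⟨ω, hω⟩, x) : {ω // π ω = y} × X)) := by
      intro a b h
      simpa using h
    obtain ⟨g, hg⟩ := Function.Embedding.schroeder_bernstein h1 h2
    exact ⟨Equiv.ofBijective g hg⟩
  let g := fun y => (key y).some
  have hg : ∀ ω x y (h : π ω = y), ((π ω, g (π ω) (⟨ω, rfl⟩, x)) : Y × X) =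
      (y, g y (⟨ω, h⟩, x)) := by
    intro ω x y h
    subst h
    rfl
  refine ⟨Equiv.ofBijective (fun z => (π z.1, g (π z.1) (⟨z.1, rfl⟩, z.2))) ⟨?_, ?_⟩, fun _ => rfl⟩
  · rintro ⟨a, x⟩ ⟨b, x'⟩ h
    simp only at h
    have hab : π a = π b := congrArg Prod.fst h
    rw [hg a x _ hab] at h
    have := (g (π b)).injective (congrArg Prod.snd h)
    simpa using this
  · rintro ⟨y, x⟩
    refine ⟨(((g y).symm x).1.1, ((g y).symm x).2), ?_⟩
    simp only
    rw [hg _ _ y ((g y).symm x).1.2]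
    simp

/-- Fibrewise permutations of a product. -/
def fiberPerm (Ω S : Type) : (Ω → Equiv.Perm S) →* Equiv.Perm (Ω × S) where
  toFun φ :=
    { toFun := fun z => (z.1, φ z.1 z.2)
      invFun := fun z => (z.1, (φ z.1)⁻¹ z.2)
      left_inv := fun z => by simp
      right_inv := fun z => by simp }
  map_one' := rfl
  map_mul' _ _ := rfl

theorem fiberPerm_injective (Ω S : Type) : Function.Injective (fiberPerm Ω S) := by
  intro φ ψ h
  ext ω s
  exact congrArg Prod.snd (DFunLike.congr_fun h (ω, s))

/-- Permutations of a product acting on the first factor. -/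
def basePerm (Ω S : Type) : Equiv.Perm Ω →* Equiv.Perm (Ω × S) where
  toFun e := Equiv.prodCongr e (Equiv.refl S)
  map_one' := rfl
  map_mul' _ _ := rfl

theorem basePerm_mul_fiberPerm {Ω S : Type} (e : Equiv.Perm Ω) (φ ψ : Ω → Equiv.Perm S)
    (h : ∀ ω, φ ω = ψ (e ω)) :
    basePerm Ω S e * fiberPerm Ω S φ = fiberPerm Ω S ψ * basePerm Ω S e := by
  ext ⟨ω, s⟩ : 1
  change (e ω, φ ω s) = (e ω, ψ (e ω) s)
  rw [h]

theorem exists_perm_commutator_pow_ne_one :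
    ∃ A B : Equiv.Perm (ℤ × ℤ), ∀ n : ℕ, 0 < n → (A * B * A⁻¹ * B⁻¹) ^ n ≠ 1 := by
  let A : Equiv.Perm (ℤ × ℤ) :=
    ⟨fun z => (z.1, z.2 + z.1), fun z => (z.1, z.2 - z.1), fun z => by simp, fun z => by simp⟩
  let B : Equiv.Perm (ℤ × ℤ) :=
    ⟨fun z => (z.1 + 1, z.2), fun z => (z.1 - 1, z.2), fun z => by simp, fun z => by simp⟩
  refine ⟨A, B, fun n hn h => ?_⟩
  have h1 : ∀ z, (A * B * A⁻¹ * B⁻¹) z = (z.1, z.2 + 1) := by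
    intro z
    change A (B (A.symm (B.symm z))) = _
    simp only [A, B, Equiv.coe_fn_mk, Equiv.coe_fn_symm_mk]
    ext
    · simp
    · simp only; ring
  have h2 : ∀ n : ℕ, ∀ z, ((A * B * A⁻¹ * B⁻¹) ^ n) z = (z.1, z.2 + n) := by
    intro n
    induction n with
    | zero => intro z; simp
    | succ k ih =>
      intro z
      rw [pow_succ, Equiv.Perm.mul_apply, h1, ih]
      ext
      · simp
      · push_cast; ring
  have h3 := h2 n (0, 0)
  rw [h] at h3
  have := congrArg Prod.snd h3
  simp at this
  omega

variable {V Q : Type} [AddCommGroup V]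

/-- Pairs of labellings of `V`, the second one avoiding the translates of `E` by the first. -/
abbrev Labelling (E : Q → V → Prop) : Type :=
  {d : (V → Prop) × (Q → V → Prop) // ∀ p q v, d.1 p → E q v → ¬ d.2 q (p + v)}

/-- Pairs of subsets of `V`, the second one avoiding the translates of `e` by the first. -/
abbrev AvoidingPair (e : V → Prop) : Type :=
  {y : (V → Prop) × (V → Prop) // ∀ l m, y.1 l → e m → ¬ y.2 (l + m)}

theorem exists_normal_form (E : Q → V → Prop) (q : Q) (a : V) (M : V →+ V)
    (hM : Function.Injective M) (e : V → Prop) (he : ∀ l, E q (a + M l) ↔ e l) :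
    ∃ F : Labelling E × V × List (Labelling E × V) ≃
        AvoidingPair e × V × List (Labelling E × V),
      (∀ d p x l, F (d, p + M l, x) =
        ((F (d, p, x)).1, (F (d, p, x)).2.1 + l, (F (d, p, x)).2.2)) ∧
      (∀ z, (F z).1.1.1 (F z).2.1 ↔ z.1.1.1 z.2.1) ∧
      (∀ z, (F z).1.1.2 (F z).2.1 ↔ z.1.1.2 q (z.2.1 + a)) := by
  classical
  let J := V ⧸ M.range
  let σ : J → V := Quotient.out
  have hσ : ∀ j : J, (QuotientAddGroup.mk (σ j) : J) = j := fun j => Quotient.out_eq' j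
  have hex : ∀ p : V, ∃ l, p = σ (QuotientAddGroup.mk p) + M l := by
    intro p
    have : (QuotientAddGroup.mk (σ (QuotientAddGroup.mk p)) : J) = QuotientAddGroup.mk p := hσ _
    rw [QuotientAddGroup.eq] at this
    obtain ⟨l, hl⟩ := this
    exact ⟨l, by rw [hl]; abel⟩
  choose L hL using hex
  have hmk : ∀ p l, (QuotientAddGroup.mk (p + M l) : J) = QuotientAddGroup.mk p := by
    intro p l
    rw [QuotientAddGroup.eq]
    exact ⟨-l, by simp⟩
  have hLadd : ∀ p l, L (p + M l) = L p + l := by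
    intro p l
    have h1 := hL (p + M l)
    rw [hmk] at h1
    have h2 := hL p
    apply hM
    rw [map_add]
    have h3 : σ (QuotientAddGroup.mk p) + M (L (p + M l)) =
        σ (QuotientAddGroup.mk p) + (M (L p) + M l) := by
      rw [← h1, ← add_assoc, ← h2]
    exact add_left_cancel h3
  have hLσ : ∀ j, L (σ j) = 0 := by
    intro j
    have h1 := hL (σ j)
    rw [hσ] at h1
    apply hM
    rw [map_zero]
    exact (left_eq_add.mp h1)
  let split : V ≃ J × V :=
    { toFun := fun p => (QuotientAddGroup.mk p, L p)
      invFun := fun z => σ z.1 + M z.2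
      left_inv := fun p => (hL p).symm
      right_inv := fun z => by
        ext
        · exact (hmk _ _).trans (hσ _)
        · simp [hLadd, hLσ] }
  let π : Labelling E × J → AvoidingPair e := fun z =>
    ⟨(fun l => z.1.1.1 (σ z.2 + M l), fun l => z.1.1.2 q (σ z.2 + M l + a)), by
      intro l m h1 h2 h3
      refine z.1.2 _ q (a + M m) h1 ((he m).2 h2) ?_
      have : σ z.2 + M l + (a + M m) = σ z.2 + M (l + m) + a := by rw [map_add]; abel
      rw [this]
      exact h3⟩
  have hπ : Function.Surjective π := by
    rintro ⟨⟨f1, f2⟩, hf⟩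
    let j : J := QuotientAddGroup.mk 0
    refine ⟨(⟨(fun p => ∃ l, p = σ j + M l ∧ f1 l,
      fun q' u => q' = q ∧ ∃ l, u = σ j + M l + a ∧ f2 l), ?_⟩, j), ?_⟩
    · rintro p q' v ⟨l, rfl, hl⟩ hE ⟨rfl, m, hm, h2⟩
      have hv : v = a + M (m - l) := by
        rw [map_sub, ← sub_eq_zero]
        rw [← sub_eq_zero] at hm
        rw [← hm]; abel
      rw [hv] at hE
      refine hf l (m - l) hl ((he _).1 hE) ?_
      simpa using h2
    · apply Subtype.ext
      ext l
      · simp only [π]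
        constructor
        · rintro ⟨l', h1, h2⟩
          rwa [hM (add_left_cancel h1)]
        · intro h
          exact ⟨l, rfl, h⟩
      · simp only [π]
        constructor
        · rintro ⟨-, l', h1, h2⟩
          rwa [hM (add_left_cancel (add_right_cancel h1))]
        · intro h
          exact ⟨trivial, l, rfl, h⟩
  let f : (Labelling E × J) × List (Labelling E × V) → List (Labelling E × V) :=
    fun z => (z.1.1, σ z.1.2) :: z.2
  have hf : Function.Injective f := by
    rintro ⟨⟨d, j⟩, x⟩ ⟨⟨d', j'⟩, x'⟩ h
    simp only [f, List.cons.injEq, Prod.mk.injEq] at h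
    obtain ⟨⟨h1, h2⟩, h3⟩ := h
    have : j = j' := by rw [← hσ j, ← hσ j', h2]
    simp [h1, this, h3]
  obtain ⟨u, hu⟩ := exists_equiv_prod_of_surjective hπ hf
  let F : Labelling E × V × List (Labelling E × V) ≃
        AvoidingPair e × V × List (Labelling E × V) :=
    { toFun := fun z => ((u ((z.1, QuotientAddGroup.mk z.2.1), z.2.2)).1, L z.2.1,
        (u ((z.1, QuotientAddGroup.mk z.2.1), z.2.2)).2)
      invFun := fun z => ((u.symm (z.1, z.2.2)).1.1,
        split.symm ((u.symm (z.1, z.2.2)).1.2, z.2.1), (u.symm (z.1, z.2.2)).2)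
      left_inv := fun z => by
        simp only [Prod.mk.eta, Equiv.symm_apply_apply]
        ext1
        · rfl
        · ext1
          · exact split.symm_apply_apply z.2.1
          · rfl
      right_inv := fun z => by
        have h := split.apply_symm_apply ((u.symm (z.1, z.2.2)).1.2, z.2.1)
        have h1 := congrArg Prod.fst h
        have h2 := congrArg Prod.snd h
        simp only [split, Equiv.coe_fn_mk] at h1 h2
        simp only [split]
        rw [h1, h2]
        simp }
  refine ⟨F, ?_, ?_, ?_⟩
  · intro d p x l
    simp only [F, Equiv.coe_fn_mk, hmk, hLadd]
  · intro z
    simp only [F, Equiv.coe_fn_mk, hu, π]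
    rw [← hL]
  · intro z
    simp only [F, Equiv.coe_fn_mk, hu, π]
    rw [← hL]

theorem exists_perm_model {ι : Type} (E : Q → V → Prop) (src tgt : ι → Q) (a b : ι → V)
    (M N : ι → V →+ V) (hM : ∀ i, Function.Injective (M i)) (hN : ∀ i, Function.Injective (N i))
    (hE : ∀ i l, E (src i) (a i + M i l) ↔ E (tgt i) (b i + N i l)) :
    ∃ (G : Type) (_ : Group G) (x : Multiplicative V →* G) (k : G) (T : Q → V → G) (r : ι → G),
      (∀ q v w, T q (v + w) = x (.ofAdd (-w)) * T q v * x (.ofAdd w)) ∧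
      (∀ i l, r i * x (.ofAdd (M i l)) = x (.ofAdd (N i l)) * r i) ∧
      (∀ i, r i * k = k * r i) ∧
      (∀ i, r i * T (src i) (a i) = T (tgt i) (b i) * r i) ∧
      (∀ q v, E q v → k * T q v = T q v * k) ∧
      (∀ q v, ¬ E q v → ∀ n : ℕ, 0 < n → (k * T q v * k⁻¹ * (T q v)⁻¹) ^ n ≠ 1) := by
  classical
  obtain ⟨A, B, hAB⟩ := exists_perm_commutator_pow_ne_one
  let Ω := Labelling E × V × List (Labelling E × V)
  let S := ℤ × ℤ
  let sh : Multiplicative V →* Equiv.Perm Ω :=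
    { toFun := fun w => Equiv.prodCongr (Equiv.refl _)
        (Equiv.prodCongr (Equiv.addRight w.toAdd) (Equiv.refl _))
      map_one' := by ext ω : 1; simp [Ω]
      map_mul' := fun v w => by
        ext ω : 1
        change (ω.1, ω.2.1 + (v.toAdd + w.toAdd), ω.2.2) =
          (ω.1, ω.2.1 + w.toAdd + v.toAdd, ω.2.2)
        rw [add_comm v.toAdd, add_assoc] }
  let κ : Ω → Equiv.Perm S := fun ω => if ω.1.1.1 ω.2.1 then A else 1
  let θ : Q → V → Ω → Equiv.Perm S := fun q v ω => if ω.1.1.2 q (ω.2.1 + v) then B else 1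
  have hr : ∀ i, ∃ r : Equiv.Perm Ω,
      (∀ l ω, r (sh (.ofAdd (M i l)) ω) = sh (.ofAdd (N i l)) (r ω)) ∧
      (∀ ω, κ ω = κ (r ω)) ∧ (∀ ω, θ (src i) (a i) ω = θ (tgt i) (b i) (r ω)) := by
    intro i
    obtain ⟨F, hF1, hF2, hF3⟩ := exists_normal_form E (src i) (a i) (M i) (hM i)
      (fun l => E (src i) (a i + M i l)) (fun l => Iff.rfl)
    obtain ⟨F', hF1', hF2', hF3'⟩ := exists_normal_form E (tgt i) (b i) (N i) (hN i)
      (fun l => E (src i) (a i + M i l)) (fun l => (hE i l).symm)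
    refine ⟨F.trans F'.symm, ?_, ?_, ?_⟩
    · rintro l ⟨d, p, x⟩
      simp only [Equiv.trans_apply]
      rw [Equiv.symm_apply_eq]
      change F (d, p + M i l, x) = F' (((F'.symm (F (d, p, x)))).1,
        ((F'.symm (F (d, p, x)))).2.1 + N i l, ((F'.symm (F (d, p, x)))).2.2)
      rw [hF1, hF1']
      simp
    · intro ω
      have h := hF2' (F'.symm (F ω))
      rw [Equiv.apply_symm_apply, hF2] at h
      simp only [κ, Equiv.trans_apply, h]
    · intro ω
      have h := hF3' (F'.symm (F ω))
      rw [Equiv.apply_symm_apply, hF3] at h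
      simp only [θ, Equiv.trans_apply, h]
  choose r hr1 hr2 hr3 using hr
  refine ⟨Equiv.Perm (Ω × S), inferInstance, (basePerm Ω S).comp sh, fiberPerm Ω S κ,
    fun q v => fiberPerm Ω S (θ q v), fun i => basePerm Ω S (r i), ?_, ?_, ?_, ?_, ?_, ?_⟩
  · intro q v w
    rw [ofAdd_neg, map_inv, mul_assoc, eq_inv_mul_iff_mul_eq]
    refine basePerm_mul_fiberPerm _ _ _ fun ω => ?_
    change θ q (v + w) ω = θ q v (ω.1, ω.2.1 + w, ω.2.2)
    simp only [θ]
    rw [add_comm v w, add_assoc]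
  · intro i l
    simp only [MonoidHom.comp_apply, ← map_mul]
    congr 1
    ext ω : 1
    exact hr1 i l ω
  · intro i
    exact basePerm_mul_fiberPerm _ _ _ (hr2 i)
  · intro i
    exact basePerm_mul_fiberPerm _ _ _ (hr3 i)
  · intro q v h
    simp only [← map_mul]
    congr 1
    funext ω
    simp only [Pi.mul_apply, κ, θ]
    by_cases h1 : ω.1.1.1 ω.2.1
    · have := ω.1.2 _ q v h1 h
      simp [this]
    · simp [h1]
  · intro q v h n hn hpow
    simp only [← map_mul, ← map_inv, ← map_pow] at hpow
    have h1 := fiberPerm_injective Ω S (hpow.trans (map_one _).symm)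
    let d : Labelling E := ⟨(fun p => p = 0, fun q' v' => q' = q ∧ v' = v), by
      rintro p q' v' rfl h2 ⟨rfl, h3⟩
      rw [zero_add] at h3
      exact h (h3 ▸ h2)⟩
    have h2 := congrFun h1 (d, 0, [])
    simp [κ, θ, d] at h2
    exact hAB n hn h2

end PermutationModel

section Amalgam

theorem exists_equivariant_equiv {C G X : Type} [Group C] [Group G] {f : C →* G}
    (hf : Function.Injective f) {φ : G × X → X} (hφ : Function.Injective φ) :
    ∃ N : G × X ≃ C × X, ∀ c a x, N (f c * a, x) = (c * (N (a, x)).1, (N (a, x)).2) := by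
  let J := G ⧸ f.range
  let σ : J → G := Quotient.out
  have hσ : ∀ j : J, (QuotientGroup.mk (σ j) : J) = j := fun j => Quotient.out_eq' j
  have hex : ∀ p : G, ∃ l, p = σ (QuotientGroup.mk p) * f l := by
    intro p
    have : (QuotientGroup.mk (σ (QuotientGroup.mk p)) : J) = QuotientGroup.mk p := hσ _
    rw [QuotientGroup.eq] at this
    obtain ⟨l, hl⟩ := this
    exact ⟨l, by rw [hl]; group⟩
  choose L hL using hex
  have hmk : ∀ p l, (QuotientGroup.mk (p * f l) : J) = QuotientGroup.mk p := by
    intro p l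
    rw [QuotientGroup.eq]
    exact ⟨l⁻¹, by simp⟩
  have hLmul : ∀ p l, L (p * f l) = L p * l := by
    intro p l
    have h1 := hL (p * f l)
    rw [hmk] at h1
    have h2 := hL p
    apply hf
    rw [map_mul]
    have h3 : σ (QuotientGroup.mk p) * f (L (p * f l)) =
        σ (QuotientGroup.mk p) * (f (L p) * f l) := by
      rw [← h1, ← mul_assoc, ← h2]
    exact mul_left_cancel h3
  have hLσ : ∀ j, L (σ j) = 1 := by
    intro j
    have h1 := hL (σ j)
    rw [hσ] at h1
    apply hf
    rw [map_one]
    exact left_eq_mul.mp h1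
  have hJ : Function.Injective (fun z : J × X => φ (σ z.1, z.2)) := by
    rintro ⟨j, x⟩ ⟨j', x'⟩ h
    have h := hφ h
    simp only [Prod.mk.injEq] at h
    have : j = j' := by rw [← hσ j, ← hσ j', h.1]
    rw [this, h.2]
  obtain ⟨u, -⟩ := exists_equiv_prod_of_surjective (π := fun _ : J => ())
    (fun _ => ⟨QuotientGroup.mk 1, rfl⟩) hJ
  refine ⟨{ toFun := fun z => ((L z.1⁻¹)⁻¹, (u (QuotientGroup.mk z.1⁻¹, z.2)).2)
            invFun := fun z => ((σ (u.symm ((), z.2)).1 * f z.1⁻¹)⁻¹, (u.symm ((), z.2)).2)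
            left_inv := fun z => ?_
            right_inv := fun z => ?_ }, fun c a x => ?_⟩
  · simp only [inv_inv]
    have : u.symm ((), (u (QuotientGroup.mk z.1⁻¹, z.2)).2) = (QuotientGroup.mk z.1⁻¹, z.2) := by
      rw [Equiv.symm_apply_eq]
    rw [this, ← hL]
    simp
  · simp only [inv_inv, hmk, hσ, hLmul, hLσ]
    simp
  · simp only [Equiv.coe_fn_mk, mul_inv_rev, ← map_inv, hmk, hLmul]
    simp

theorem exists_amalgam {C G H ι : Type} [Group C] [Group G] [Group H] {f : ι → C →* G}
    (hf : ∀ i, Function.Injective (f i)) {g : C →* H} (hg : Function.Injective g) :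
    ∃ (L : Type) (_ : Group L) (jG : G →* L) (jH : ι → H →* L), Function.Injective jG ∧
      (∀ i, Function.Injective (jH i)) ∧ ∀ i c, jG (f i c) = jH i (g c) := by
  let X := List (G ⊕ H)
  have h1 : Function.Injective (fun z : G × X => (Sum.inl z.1 :: z.2 : X)) := by
    rintro ⟨a, x⟩ ⟨b, y⟩ h
    simpa using h
  have h2 : Function.Injective (fun z : H × X => (Sum.inr z.1 :: z.2 : X)) := by
    rintro ⟨a, x⟩ ⟨b, y⟩ h
    simpa using h
  choose N hN using fun i => exists_equivariant_equiv (hf i) h1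
  obtain ⟨N', hN'⟩ := exists_equivariant_equiv hg h2
  let mulPerm (K : Type) [Group K] : K →* Equiv.Perm (K × X) :=
    (basePerm K X).comp (MulAction.toPermHom K K)
  have hmul : ∀ (K : Type) [Group K], Function.Injective (mulPerm K) := by
    intro K _ a b h
    have := congrArg Prod.fst (DFunLike.congr_fun h ((1, []) : K × X))
    change a * 1 = b * 1 at this
    simpa using this
  let e := fun i => (N i).trans N'.symm
  refine ⟨Equiv.Perm (G × X), inferInstance, mulPerm G,
    fun i => (e i).symm.permCongrHom.toMonoidHom.comp (mulPerm H), hmul G, fun i => ?_,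
    fun i c => ?_⟩
  · exact (e i).symm.permCongrHom.injective.comp (hmul H)
  · ext ⟨a, x⟩ : 1
    change (f i c * a, x) = (e i).symm (g c * (e i (a, x)).1, (e i (a, x)).2)
    rw [Equiv.eq_symm_apply]
    simp only [e, Equiv.trans_apply]
    rw [hN, Equiv.symm_apply_eq, hN']
    simp

end Amalgam

section TorsionVertexGroup

open scoped Function Pointwise

theorem lift_injective_of_zpow_ping_pong {D α : Type} [Group D] [MulAction D α] (a : Bool → D)
    (X : Bool → Set α) (hne : ∀ i, (X i).Nonempty) (hd : Pairwise (Disjoint on X))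
    (h : Pairwise fun i j => ∀ n : ℤ, n ≠ 0 → a i ^ n • X j ⊆ X i) :
    Function.Injective (FreeGroup.lift a) := by
  have h1 : FreeGroup.lift a =
      (Monoid.CoprodI.lift fun i => FreeGroup.lift fun _ : Unit => a i).comp
        (@freeGroupEquivCoprodI Bool).toMonoidHom := by
    ext i
    simp
  rw [h1, MonoidHom.coe_comp]
  refine Function.Injective.comp ?_ freeGroupEquivCoprodI.injective
  have : Infinite (FreeGroup Unit) := Infinite.of_injective _
    FreeGroup.freeGroupUnitEquivInt.symm.injective
  refine Monoid.CoprodI.lift_injective_of_ping_pong _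
    (.inr ⟨true, (Cardinal.ofNat_lt_aleph0.le.trans (Cardinal.aleph0_le_mk _))⟩) X hne hd ?_
  intro i j hij
  refine FreeGroup.freeGroupUnitEquivInt.forall_congr_left.mpr fun n hn => ?_
  have hn0 : n ≠ 0 := by
    rintro rfl
    exact hn (by simp [FreeGroup.freeGroupUnitEquivInt])
  change FreeGroup.lift (fun _ => a i) (FreeGroup.of () ^ n) • X j ⊆ X i
  simpa using h hij n hn0

theorem exists_order_four_three :
    ∃ (D : Type) (_ : Group D) (x y : D), x ^ 4 = 1 ∧ y ^ 3 = 1 ∧ x ^ 2 ≠ 1 ∧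
      Function.Injective (FreeGroup.lift (fun b : Bool =>
        if b then x * y else x * (x * y) ^ (-4 : ℤ) * x⁻¹)) := by
  let x : Equiv.Perm (ℤ × ℤ) :=
    ⟨fun z => (-z.2, z.1), fun z => (z.2, -z.1), fun z => by simp, fun z => by simp⟩
  let T : Equiv.Perm (ℤ × ℤ) :=
    ⟨fun z => (z.1 + z.2, z.2), fun z => (z.1 - z.2, z.2), fun z => by simp, fun z => by simp⟩
  have hT : ∀ (n : ℤ) z, (T ^ n) z = (z.1 + n * z.2, z.2) := by
    intro n
    induction n using Int.induction_on with
    | zero => simp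
    | succ k ih =>
      intro z
      rw [zpow_add_one, Equiv.Perm.mul_apply, ih]
      ext
      · simp [T]; ring
      · rfl
    | pred k ih =>
      intro z
      rw [zpow_sub_one, Equiv.Perm.mul_apply, ih]
      change ((z.1 - z.2) + _ * z.2, z.2) = _
      ext
      · push_cast; ring
      · rfl
  let L := x * T ^ (-4 : ℤ) * x⁻¹
  have hL : ∀ (n : ℤ) z, (L ^ n) z = (z.1, z.2 + 4 * n * z.1) := by
    intro n z
    have : L ^ n = x * T ^ (-4 * n) * x⁻¹ := by
      rw [zpow_mul]; exact conj_zpow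
    rw [this, Equiv.Perm.mul_apply, Equiv.Perm.mul_apply, hT]
    change (- -z.1, z.2 + -4 * n * -z.1) = _
    ext
    · simp
    · simp
  have hxy : x * (x⁻¹ * T) = T := by group
  refine ⟨Equiv.Perm (ℤ × ℤ), inferInstance, x, x⁻¹ * T, ?_, ?_, ?_, ?_⟩
  · ext z : 1
    rw [pow_succ, pow_succ, pow_two]
    change (- -z.1, - -z.2) = z
    simp
  · ext z : 1
    rw [pow_succ, pow_two]
    have : ∀ z, (x⁻¹ * T) z = (z.2, -(z.1 + z.2)) := fun _ => rfl
    simp only [Equiv.Perm.mul_apply, this]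
    ext <;> simp
  · intro h
    have h := congrArg Prod.fst (DFunLike.congr_fun h (1, 0))
    change (-1 : ℤ) = 1 at h
    omega
  · rw [hxy]
    let X : Bool → Set (ℤ × ℤ) := fun b =>
      if b then {z | |z.2| < 2 * |z.1|} else {z | 2 * |z.1| < |z.2|}
    refine lift_injective_of_zpow_ping_pong _ X ?_ ?_ ?_
    · rintro (_ | _)
      · exact ⟨(0, 1), by simp [X]⟩
      · exact ⟨(1, 0), by simp [X]⟩
    · rintro (_ | _) (_ | _) hij
      · exact absurd rfl hij
      · refine Set.disjoint_left.2 fun z h1 h2 => ?_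
        simp [X] at h1 h2
        omega
      · refine Set.disjoint_left.2 fun z h1 h2 => ?_
        simp [X] at h1 h2
        omega
      · exact absurd rfl hij
    · rintro (_ | _) (_ | _) hij n hn
      · exact absurd rfl hij
      · rintro _ ⟨z, hz, rfl⟩
        change (L ^ n) z ∈ _
        rw [hL]
        simp only [X, if_true, Set.mem_ofPred_eq] at hz
        simp only [X, Bool.false_eq_true, if_false, Set.mem_ofPred_eq]
        have h1 : |z.1| ≤ |n * z.1| := by
          rw [abs_mul]
          exact le_mul_of_one_le_left (abs_nonneg _) (Int.one_le_abs hn)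
        rw [mul_assoc]
        generalize n * z.1 = u at h1 ⊢
        simp only [Int.abs_eq_natAbs] at *
        omega
      · rintro _ ⟨z, hz, rfl⟩
        change (T ^ n) z ∈ _
        rw [hT]
        simp only [X, Bool.false_eq_true, if_false, Set.mem_ofPred_eq] at hz
        simp only [X, if_true, Set.mem_ofPred_eq]
        have h1 : |z.2| ≤ |n * z.2| := by
          rw [abs_mul]
          exact le_mul_of_one_le_left (abs_nonneg _) (Int.one_le_abs hn)
        generalize n * z.2 = u at h1 ⊢
        simp only [Int.abs_eq_natAbs] at *
        omega
      · exact absurd rfl hij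

end TorsionVertexGroup

section ModularMachine

/-- A modular machine on `ℤ × ℤ` with finitely many reversible affine instructions, together with
the set `E` of configurations linked to the halting one. -/
structure ModularMachine where
  Q : Type
  ι : Type
  [finQ : Fintype Q]
  [finι : Fintype ι]
  start : Q
  halt : Q
  src : ι → Q
  tgt : ι → Q
  a : ι → ℤ × ℤ
  b : ι → ℤ × ℤ
  M : ι → ℤ × ℤ
  N : ι → ℤ × ℤ
  M_ne : ∀ i, (M i).1 ≠ 0 ∧ (M i).2 ≠ 0
  N_ne : ∀ i, (N i).1 ≠ 0 ∧ (N i).2 ≠ 0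
  E : Q → ℤ × ℤ → Prop
  E_iff : ∀ i l, E (src i) (a i + M i * l) ↔ E (tgt i) (b i + N i * l)
  E_halt : E halt 0
  E_induction : ∀ P : Q → ℤ × ℤ → Prop, P halt 0 →
    (∀ i l, P (src i) (a i + M i * l) ↔ P (tgt i) (b i + N i * l)) → ∀ q v, E q v → P q v

attribute [instance] ModularMachine.finQ ModularMachine.finι

namespace ModularMachine

open Turing

variable {Γ Λ : Type} [Inhabited Γ] [Inhabited Λ]

section Simulation

variable (T : TM0.Machine Γ Λ) (b : ℤ) (code : Γ → ℤ) (sym : ℤ → Γ)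

/-- The effect of a statement on the configuration `(α, β)`. -/
def act : TM0.Stmt Γ → ℤ × ℤ → ℤ × ℤ
  | .write g, v => (v.1, v.2 - v.2 % b + code g)
  | .move .right, v => (b * v.1 + v.2 % b, v.2 / b)
  | .move .left, v => (v.1 / b, b * v.2 + v.1 % b)

/-- Simulation of a Turing machine with the tape stored in base `b`. -/
def zstep (c : Λ × ℤ × ℤ) : Option (Λ × ℤ × ℤ) :=
  (T c.1 (sym (c.2.2 % b))).map fun z => (z.1, act b code z.2 c.2)

/-- The half tape `L` is stored by the digits of `n`. -/
def Stores (L : ListBlank Γ) (n : ℤ) : Prop := ∀ i : ℕ, L.nth i = sym (n / b ^ i % b)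

variable {b code sym}

theorem Stores.head {L : ListBlank Γ} {n : ℤ} (h : Stores b sym L n) : L.head = sym (n % b) := by
  simpa using h 0

theorem Stores.tail {L : ListBlank Γ} {n : ℤ} (hb : 0 < b) (h : Stores b sym L n) :
    Stores b sym L.tail (n / b) := by
  intro i
  rw [← ListBlank.nth_succ, h, pow_succ', Int.ediv_ediv_of_nonneg hb.le]

theorem Stores.cons {L : ListBlank Γ} {n c : ℤ} (hc0 : 0 ≤ c) (hcb : c < b)
    (h : Stores b sym L n) : Stores b sym (L.cons (sym c)) (b * n + c) := by
  have hb : 0 < b := hc0.trans_lt hcb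
  rintro (_ | i)
  · simp [Int.add_emod, Int.emod_eq_of_lt hc0 hcb]
  · rw [ListBlank.nth_succ, ListBlank.tail_cons, h, pow_succ', ← Int.ediv_ediv_of_nonneg hb.le,
      Int.mul_add_ediv_left _ _ hb.ne', Int.ediv_eq_zero_of_lt hc0 hcb, add_zero]

/-- Correspondence between configurations of the Turing machine and numbers. -/
def Corr (b : ℤ) (sym : ℤ → Γ) (c : TM0.Cfg Γ Λ) (d : Λ × ℤ × ℤ) : Prop :=
  c.q = d.1 ∧ c.Tape.head = sym (d.2.2 % b) ∧ Stores b sym c.Tape.left d.2.1 ∧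
    Stores b sym c.Tape.right (d.2.2 / b)

theorem respects_zstep (hb : 0 < b) (hc : ∀ g, 0 ≤ code g ∧ code g < b ∧ sym (code g) = g) :
    StateTransition.Respects (TM0.step T) (zstep T b code sym) (Corr b sym) := by
  rintro ⟨q, T'⟩ ⟨q', α, β⟩ ⟨rfl, h1, h2, h3⟩
  simp only at h1 h2 h3
  rcases e : T q T'.head with _ | ⟨p, s⟩
  · simp [TM0.step, zstep, ← h1, e]
  simp only [TM0.step, e, Option.map_some]
  refine ⟨(p, act b code s (α, β)), ?_, Relation.TransGen.single (by simp [zstep, ← h1, e])⟩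
  have hm0 := Int.emod_nonneg β hb.ne'
  have hm1 := Int.emod_lt_of_pos β hb
  have hn0 := Int.emod_nonneg α hb.ne'
  have hn1 := Int.emod_lt_of_pos α hb
  rcases s with (_ | _) | g
  · refine ⟨rfl, ?_, ?_, ?_⟩
    · simp only [Tape.move, act]
      rw [h2.head, Int.mul_add_emod_self_left, Int.emod_emod_of_dvd _ dvd_rfl]
    · exact h2.tail hb
    · simp only [Tape.move, act, h1]
      rw [Int.mul_add_ediv_left _ _ hb.ne', Int.ediv_eq_zero_of_lt hn0 hn1, add_zero]
      conv_rhs => rw [← Int.mul_ediv_add_emod β b]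
      exact h3.cons hm0 hm1
  · refine ⟨rfl, h3.head, ?_, h3.tail hb⟩
    simp only [Tape.move, act, h1]
    exact h2.cons hm0 hm1
  · obtain ⟨g0, g1, g2⟩ := hc g
    have h4 : β - β % b + code g = b * (β / b) + code g := by
      have := Int.mul_ediv_add_emod β b
      linarith
    refine ⟨rfl, ?_, h2, ?_⟩
    · simp only [Tape.write, act]
      rw [h4, Int.mul_add_emod_self_left, Int.emod_eq_of_lt g0 g1, g2]
    · simp only [Tape.write, act]
      rw [h4, Int.mul_add_ediv_left _ _ hb.ne', Int.ediv_eq_zero_of_lt g0 g1, add_zero]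
      exact h3

theorem stores_mk (hc : ∀ g, 0 ≤ code g ∧ code g < b ∧ sym (code g) = g)
    (h0 : sym 0 = default) (L : List Γ) :
    Stores b sym (ListBlank.mk L) (L.foldr (fun g r => b * r + code g) 0) := by
  induction L with
  | nil =>
    intro i
    simp [h0]
  | cons g L ih =>
    have := ih.cons (hc g).1 (hc g).2.1
    rw [(hc g).2.2, ListBlank.cons_mk] at this
    exact this

theorem corr_init (hb : 0 < b) (hc : ∀ g, 0 ≤ code g ∧ code g < b ∧ sym (code g) = g)
    (h0 : sym 0 = default) (L : List Γ) :
    Corr b sym (TM0.init L : TM0.Cfg Γ Λ)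
      (default, 0, L.foldr (fun g r => b * r + code g) 0) := by
  have h := stores_mk hc h0 L
  refine ⟨rfl, h.head, ?_, h.tail hb⟩
  intro i
  simp [TM0.init, Tape.mk₁, Tape.mk₂, h0]

end Simulation

open StateTransition in
theorem exists_of_turing_machine [Fintype Γ] [Fintype Λ] (T : TM0.Machine Γ Λ) :
    ∃ (A : ModularMachine) (b : ℕ) (code : Γ → ℕ), ∀ L : List Γ,
      A.E A.start (0, ((L.foldr (fun g r => b * r + code g) 0 : ℕ) : ℤ)) ↔
        (eval (TM0.step T) (TM0.init L)).Dom := by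
  classical
  let e := Fintype.equivFin Γ
  let b : ℕ := Fintype.card Γ + 1
  let code : Γ → ℕ := fun g => e g + 1
  let codeZ : Γ → ℤ := fun g => code g
  let sym : ℤ → Γ := fun n => if h : 0 < n ∧ n.toNat - 1 < Fintype.card Γ then
    e.symm ⟨n.toNat - 1, h.2⟩ else default
  have hb : (0 : ℤ) < b := by simp [b]
  have h0 : sym 0 = default := by simp [sym]
  have hc : ∀ g, 0 ≤ codeZ g ∧ codeZ g < b ∧ sym (codeZ g) = g := by
    intro g
    refine ⟨by simp [codeZ], ?_, ?_⟩
    · have := (e g).2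
      simp only [codeZ, code, b]
      omega
    · have h1 : (0 : ℤ) < (code g : ℤ) ∧ (code g : ℤ).toNat - 1 < Fintype.card Γ := by
        have := (e g).2
        simp only [code, Int.toNat_natCast]
        omega
      simp only [sym, codeZ, dif_pos h1]
      rw [Equiv.symm_apply_eq]
      ext
      simp [code]
  let f := zstep T b codeZ sym
  let E : Option Λ → ℤ × ℤ → Prop := fun q v => ∀ q', q = some q' → (eval f (q', v)).Dom
  let dig : Λ × Fin b × Fin b → ℤ × ℤ := fun z => ((z.2.1 : ℤ), (z.2.2 : ℤ))
  let instr : Λ × Fin b × Fin b → Option Λ × (ℤ × ℤ) × (ℤ × ℤ) := fun z =>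
    match T z.1 (sym z.2.2) with
    | none => (none, dig z, (b, b))
    | some (q, .write g) => (some q, (z.2.1, codeZ g), (b, b))
    | some (q, .move .right) => (some q, (b * z.2.1 + z.2.2, 0), (b * b, 1))
    | some (q, .move .left) => (some q, (0, b * z.2.2 + z.2.1), (1, b * b))
  have hdig : ∀ v : ℤ × ℤ, ∃ c d : Fin b,
      v = ((c : ℤ), (d : ℤ)) + ((b, b) : ℤ × ℤ) * (v.1 / b, v.2 / b) := by
    have : ∀ n : ℤ, ∃ c : Fin b, n = c + b * (n / b) := by
      intro n
      have h1 := Int.emod_nonneg n hb.ne'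
      have h2 := Int.emod_lt_of_pos n hb
      refine ⟨⟨(n % b).toNat, by omega⟩, ?_⟩
      have := Int.mul_ediv_add_emod n b
      simp only
      rw [Int.toNat_of_nonneg h1]
      linarith
    intro v
    obtain ⟨c, hc⟩ := this v.1
    obtain ⟨d, hd⟩ := this v.2
    exact ⟨c, d, Prod.ext hc hd⟩
  have hmod : ∀ (c : Fin b) (l : ℤ), ((c : ℤ) + b * l) % b = c := by
    intro c l
    rw [Int.add_mul_emod_self_left, Int.emod_eq_of_lt (by omega) (by have := c.2; omega)]
  have hdiv : ∀ (c : Fin b) (l : ℤ), ((c : ℤ) + b * l) / b = l := by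
    intro c l
    rw [Int.add_mul_ediv_left _ _ hb.ne', Int.ediv_eq_zero_of_lt (by omega)
      (by have := c.2; omega), zero_add]
  have hnone : ∀ z l, T z.1 (sym z.2.2) = none → f (z.1, dig z + ((b, b) : ℤ × ℤ) * l) = none := by
    intro z l h
    simp only [f, zstep, dig]
    simp [hmod, h]
  have hsome : ∀ z l p, T z.1 (sym z.2.2) = some p → ∃ q, (instr z).1 = some q ∧
      f (z.1, dig z + ((b, b) : ℤ × ℤ) * l) =
        some (q, (instr z).2.1 + (instr z).2.2 * l) := by
    intro z l p h
    rcases p with ⟨q, (_ | _) | g⟩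
    · refine ⟨q, by simp [instr, h], ?_⟩
      simp only [f, zstep, instr, h, dig]
      simp [hmod, hdiv, h, act]
      ext <;> simp
      ring
    · refine ⟨q, by simp [instr, h], ?_⟩
      simp only [f, zstep, instr, h, dig]
      simp [hmod, hdiv, h, act]
      ext <;> simp
      ring
    · refine ⟨q, by simp [instr, h], ?_⟩
      simp only [f, zstep, instr, h, dig]
      simp [hmod, h, act]
      ext <;> simp
      ring
  have hdom_none : ∀ c, f c = none → (eval f c).Dom := fun c h =>
    Part.dom_iff_mem.2 ⟨c, mem_eval.2 ⟨.refl, h⟩⟩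
  have hdom_some : ∀ c d, f c = some d → ((eval f c).Dom ↔ (eval f d).Dom) := fun c d h => by
    rw [reaches_eval (.single h)]
  let A : ModularMachine :=
    { Q := Option Λ
      ι := Λ × Fin b × Fin b ⊕ Bool
      start := some default
      halt := none
      src := Sum.elim (fun z => some z.1) fun _ => none
      tgt := Sum.elim (fun z => (instr z).1) fun _ => none
      a := Sum.elim dig fun _ => 0
      b := Sum.elim (fun z => (instr z).2.1) fun i => if i then (1, 0) else (0, 1)
      M := Sum.elim (fun _ => (b, b)) fun _ => 1
      N := Sum.elim (fun z => (instr z).2.2) fun _ => 1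
      M_ne := by
        rintro (z | i)
        · exact ⟨hb.ne', hb.ne'⟩
        · simp
      N_ne := by
        rintro (z | i)
        · simp only [Sum.elim_inl, instr]
          split <;> simp
        · simp
      E := E
      E_iff := by
        rintro (z | i) l
        · rcases h : T z.1 (sym z.2.2) with _ | p
          · have h1 : (instr z).1 = none := by simp [instr, h]
            simp only [Sum.elim_inl, E, h1]
            simp [hdom_none _ (hnone z l h)]
          · obtain ⟨q, h1, h2⟩ := hsome z l p h
            simp only [Sum.elim_inl, E, h1]
            simp [hdom_some _ _ h2]
        · simp [E]
      E_halt := fun _ h => nomatch h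
      E_induction := by
        intro P hP0 hP
        have hPn : ∀ v, P none v := by
          have h1 : ∀ v, P none v ↔ P none ((1, 0) + v) := fun v => by
            simpa using hP (.inr true) v
          have h2 : ∀ v, P none v ↔ P none ((0, 1) + v) := fun v => by
            simpa using hP (.inr false) v
          have h3 : ∀ m : ℤ, P none (m, 0) := by
            intro m
            induction m using Int.induction_on with
            | zero => exact hP0
            | succ k ih => simpa [add_comm] using (h1 _).1 ih
            | pred k ih => exact (h1 _).2 (by simpa using ih)
          rintro ⟨m, n⟩
          induction n using Int.induction_on with
          | zero => exact h3 m
          | succ k ih => simpa [add_comm] using (h2 _).1 ih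
          | pred k ih => exact (h2 _).2 (by simpa using ih)
        rintro (_ | q) v hE
        · exact hPn v
        · obtain ⟨c, hc⟩ := Part.dom_iff_mem.1 (hE q rfl)
          have key : P (some ((q, v) : Λ × ℤ × ℤ).1) ((q, v) : Λ × ℤ × ℤ).2 := by
            refine evalInduction (C := fun x => P (some x.1) x.2) hc ?_
            rintro ⟨q, v⟩ - ih
            obtain ⟨c, d, hv⟩ := hdig v
            have h1 := hP (.inl (q, c, d)) (v.1 / b, v.2 / b)
            simp only [Sum.elim_inl] at h1
            simp only at ih ⊢
            change P (some q) (((c : ℤ), (d : ℤ)) + ((b, b) : ℤ × ℤ) * (v.1 / b, v.2 / b)) ↔ _ at h1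
            rw [← hv] at h1
            rw [h1]
            rcases h : T q (sym d) with _ | p
            · have h2 : (instr (q, c, d)).1 = none := by simp [instr, h]
              rw [h2]
              exact hPn _
            · obtain ⟨q', h2, h3⟩ := hsome (q, c, d) (v.1 / b, v.2 / b) p h
              change f (q, ((c : ℤ), (d : ℤ)) + ((b, b) : ℤ × ℤ) * (v.1 / b, v.2 / b)) = _ at h3
              rw [← hv] at h3
              rw [h2]
              exact ih _ h3
          exact key }
  refine ⟨A, b, code, fun L => ?_⟩
  have h1 : ((L.foldr (fun g r => b * r + code g) 0 : ℕ) : ℤ) =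
      L.foldr (fun g r => (b : ℤ) * r + codeZ g) 0 := by
    induction L with
    | nil => rfl
    | cons g L ih => simp only [List.foldr_cons]; push_cast; rw [ih]
  rw [h1, ← tr_eval_dom (respects_zstep T hb hc) (corr_init hb hc h0 L)]
  simp [A, E, f]

end ModularMachine

end ModularMachine

section TuringMachineForRE

open Turing

theorem exists_finite_restriction {Γ Λ : Type} [Inhabited Γ] [i : Inhabited Λ] (T : TM0.Machine Γ Λ)
    (S : Finset Λ) (hS : TM0.Supports T (S : Set Λ)) :
    ∃ (Λ' : Type) (_ : Fintype Λ') (_ : Inhabited Λ') (T' : TM0.Machine Γ Λ'), ∀ L,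
      (StateTransition.eval (TM0.step T') (TM0.init L)).Dom ↔
        (StateTransition.eval (TM0.step T) (TM0.init L)).Dom := by
  classical
  let _ : Inhabited S := ⟨⟨default, hS.1⟩⟩
  let T' : TM0.Machine Γ S := fun q a =>
    (T q.1 a).bind fun z => if h : z.1 ∈ S then some (⟨z.1, h⟩, z.2) else none
  refine ⟨S, inferInstance, inferInstance, T', fun L => ?_⟩
  let tr : TM0.Cfg Γ S → TM0.Cfg Γ Λ := fun c => ⟨c.q.1, c.Tape⟩
  have hres : StateTransition.Respects (TM0.step T') (TM0.step T) (fun a b => tr a = b) := by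
    refine StateTransition.fun_respects.2 fun c => ?_
    obtain ⟨q, t⟩ := c
    rcases h : T q.1 t.head with _ | ⟨q', s⟩
    · simp [TM0.step, T', h, StateTransition.FRespects, tr]
    · have hq : q' ∈ S := hS.2 (Option.mem_def.2 h) q.2
      simp only [TM0.step, T', h, Option.bind_some, hq, dif_pos, Option.map_some,
        StateTransition.FRespects]
      refine Relation.TransGen.single ?_
      simp only [TM0.step, tr, h]
      rfl
  exact (StateTransition.tr_eval_dom hres (a₁ := TM0.init L) rfl).symm

theorem trNat_two_pow (n : ℕ) :
    PartrecToTM2.trNat (2 ^ n) = List.replicate n PartrecToTM2.Γ'.bit0 ++ [.bit1] := by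
  induction n with
  | zero => simp [PartrecToTM2.trNat, PartrecToTM2.trNum, PartrecToTM2.trPosNum]
  | succ n ih =>
    rw [List.replicate_succ, List.cons_append, ← ih]
    have hpos : 0 < 2 ^ n := by positivity
    rw [pow_succ, mul_two]
    generalize 2 ^ n = m at hpos ⊢
    have h1 : (((m + m : ℕ)) : Num) = Num.bit0 (m : Num) := by
      rw [Nat.cast_add, Num.bit0_of_bit0]
    have h2 : ((m : Num) : ℕ) = m := Num.to_of_nat m
    rw [PartrecToTM2.trNat, h1, PartrecToTM2.trNat]
    generalize (m : Num) = u at h2 ⊢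
    rcases u with _ | q
    · exact absurd h2 hpos.ne
    · rfl

instance : Fintype PartrecToTM2.K' :=
  ⟨{.main, .rev, .aux, .stack}, by rintro (_ | _ | _ | _) <;> simp⟩

theorem exists_turing_machine_of_code (c : ToPartrec.Code) :
    ∃ (Γ Λ : Type) (_ : Fintype Γ) (_ : Fintype Λ) (_ : Inhabited Γ) (_ : Inhabited Λ)
      (T : TM0.Machine Γ Λ) (c₀ c₁ c₂ : Γ), ∀ n : ℕ,
      (StateTransition.eval (TM0.step T) (TM0.init (c₀ :: c₁ :: List.replicate n c₂))).Dom ↔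
        (c.eval [2 ^ n]).Dom := by
  let _ : Inhabited PartrecToTM2.Λ' := ⟨PartrecToTM2.trNormal c .halt⟩
  have h1 := TM1to0.tr_supports _ (TM2to1.tr_supports _ (PartrecToTM2.tr_supports c .halt))
  obtain ⟨Λ, _, _, T, hT⟩ := exists_finite_restriction _ _ h1
  let K := PartrecToTM2.K'
  let G : K → Type := fun _ => PartrecToTM2.Γ'
  let sy : PartrecToTM2.Γ' → ∀ k : K, Option (G k) :=
    fun g => Function.update (fun _ => none) PartrecToTM2.K'.main (some g)
  refine ⟨TM2to1.Γ' K G, Λ, inferInstance, inferInstance, inferInstance, inferInstance, T,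
    (true, sy .cons), (false, sy .bit1), (false, sy .bit0), fun n => ?_⟩
  rw [hT]
  have h2 : ((true, sy .cons) :: (false, sy .bit1) :: List.replicate n (false, sy .bit0) :
      List (TM2to1.Γ' K G)) = TM2to1.trInit PartrecToTM2.K'.main (PartrecToTM2.trList [2 ^ n]) := by
    have h3 : (PartrecToTM2.trList [2 ^ n]).reverse =
        .cons :: .bit1 :: List.replicate n PartrecToTM2.Γ'.bit0 := by
      simp [PartrecToTM2.trList, trNat_two_pow]
    have h4 : List.replicate n ((false, sy .bit0) : TM2to1.Γ' K G) =
        (List.replicate n PartrecToTM2.Γ'.bit0).map fun a => (false, sy a) :=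
      (List.map_replicate (f := fun a => ((false, sy a) : TM2to1.Γ' K G))).symm
    rw [TM2to1.trInit, h3]
    exact congrArg (fun l => _ :: _ :: l) h4
  rw [h2]
  have h3 := TM1to0.tr_eval (TM2to1.tr PartrecToTM2.tr)
    (TM2to1.trInit PartrecToTM2.K'.main (PartrecToTM2.trList [2 ^ n]))
  have h4 := TM2to1.tr_eval_dom PartrecToTM2.tr PartrecToTM2.K'.main (PartrecToTM2.trList [2 ^ n])
  rw [← h3] at h4
  refine Iff.trans h4 ?_
  have h5 := PartrecToTM2.tr_eval c [2 ^ n]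
  have h6 : PartrecToTM2.init c [2 ^ n] =
      TM2.init PartrecToTM2.K'.main (PartrecToTM2.trList [2 ^ n]) := by
    simp only [PartrecToTM2.init, TM2.init]
    congr 1
    funext k
    cases k <;> rfl
  rw [h6] at h5
  change (StateTransition.eval (TM2.step PartrecToTM2.tr) _).Dom ↔ _
  rw [h5]
  rfl

theorem exists_turing_machine_of_rePred {p : ℕ → Prop} (hp : REPred p) :
    ∃ (Γ Λ : Type) (_ : Fintype Γ) (_ : Fintype Λ) (_ : Inhabited Γ) (_ : Inhabited Λ)
      (T : TM0.Machine Γ Λ) (c₀ c₁ c₂ : Γ), ∀ n : ℕ,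
      (StateTransition.eval (TM0.step T) (TM0.init (c₀ :: c₁ :: List.replicate n c₂))).Dom ↔
        p n := by
  let h : ℕ →. ℕ := fun x => (Nat.rfind fun j => Part.some (decide (x ≤ 2 ^ j))).bind fun j =>
    (Part.assert (p j) fun _ => Part.some ()).map fun _ => 0
  have hh : Partrec h := by
    refine Partrec.bind (Partrec.rfind ?_) ?_
    · have h1 : Primrec (fun j : ℕ => 2 ^ j) :=
        (Primrec.nat_rec₁ 1 ((Primrec.nat_mul.comp (.const 2) Primrec.snd).to₂ :
          Primrec₂ fun _ IH : ℕ => 2 * IH)).of_eq fun n => by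
            induction n with
            | zero => rfl
            | succ n ih => simp only at ih ⊢; rw [ih, pow_succ']
      exact (Primrec.nat_le.decide.comp Primrec.fst (h1.comp Primrec.snd)).to_comp.partrec
    · exact Partrec.map (Partrec.comp hp Computable.snd) (Computable.const 0).to₂
  obtain ⟨c, hc⟩ := ToPartrec.Code.exists_code (Nat.Partrec'.part_iff₁.2 hh)
  obtain ⟨Γ, Λ, h1, h2, h3, h4, T, c₀, c₁, c₂, hT⟩ := exists_turing_machine_of_code c
  refine ⟨Γ, Λ, h1, h2, h3, h4, T, c₀, c₁, c₂, fun n => ?_⟩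
  rw [hT]
  have h5 := hc ⟨[2 ^ n], rfl⟩
  simp only at h5
  rw [h5]
  change (h (2 ^ n)).Dom ↔ _
  have h6 : n ∈ Nat.rfind (fun j => Part.some (decide (2 ^ n ≤ 2 ^ j)) : ℕ →. Bool) := by
    refine Nat.mem_rfind.2 ⟨?_, ?_⟩
    · simp
    · intro m hm
      simpa using Nat.pow_lt_pow_right (by norm_num : 1 < 2) hm
  simp only [h]
  rw [Part.eq_some_iff.2 h6, Part.bind_some]
  simp [Part.assert]

end TuringMachineForRE

section Simulation

open Function

/-- The conjugate of `t` by `X ^ v.1 * Y ^ v.2`. -/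
def conjBy {G : Type} [Group G] (X Y t : G) (v : ℤ × ℤ) : G :=
  (X ^ v.1 * Y ^ v.2)⁻¹ * t * (X ^ v.1 * Y ^ v.2)

theorem map_conjBy {G H : Type} [Group G] [Group H] (φ : G →* H) (X Y t : G) (v : ℤ × ℤ) :
    φ (conjBy X Y t v) = conjBy (φ X) (φ Y) (φ t) v := by
  simp [conjBy]

theorem conjBy_add {G : Type} [Group G] {X Y : G} (h : SemiconjBy X Y Y) (t : G) (v w : ℤ × ℤ) :
    conjBy X Y t (v + w) = (X ^ w.1 * Y ^ w.2)⁻¹ * conjBy X Y t v * (X ^ w.1 * Y ^ w.2) := by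
  have h1 : X ^ (v + w).1 * Y ^ (v + w).2 = (X ^ v.1 * Y ^ v.2) * (X ^ w.1 * Y ^ w.2) := by
    have h2 : Y ^ v.2 * X ^ w.1 = X ^ w.1 * Y ^ v.2 :=
      (((show Commute X Y from h).zpow_zpow _ _).eq).symm
    rw [Prod.fst_add, Prod.snd_add, zpow_add, zpow_add, mul_assoc, mul_assoc,
      ← mul_assoc (X ^ w.1) (Y ^ v.2), ← h2]
    simp only [mul_assoc]
  rw [conjBy, h1, conjBy]
  group

/-- The relator expressing `SemiconjBy a x y`. -/
def semiconjRelator {F : Type} [Group F] (a x y : F) : F := a * x * (y * a)⁻¹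

theorem map_semiconjRelator_eq_one {F G : Type} [Group F] [Group G] (φ : F →* G) {a x y : F} :
    φ (semiconjRelator a x y) = 1 ↔ SemiconjBy (φ a) (φ x) (φ y) := by
  rw [semiconjRelator, map_mul, map_inv, mul_inv_eq_one, map_mul, map_mul]
  rfl

/-- The generators of the group attached to a modular machine: `Sum.inl 0` and `Sum.inl 1`
translate the two coordinates, `Sum.inl 2` centralises the terminating configurations. -/
abbrev ModularMachine.Gen (A : ModularMachine) : Type := Fin 3 ⊕ A.Q ⊕ A.ι

namespace ModularMachine

variable (A : ModularMachine)

/-- The relators of the group attached to a modular machine. -/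
def relators : Set (FreeGroup A.Gen) :=
  let X := FreeGroup.of (.inl 0 : A.Gen)
  let Y := FreeGroup.of (.inl 1 : A.Gen)
  let k := FreeGroup.of (.inl 2 : A.Gen)
  let t : A.Q → FreeGroup A.Gen := fun q => .of (.inr (.inl q))
  let r : A.ι → FreeGroup A.Gen := fun i => .of (.inr (.inr i))
  {semiconjRelator X Y Y, semiconjRelator k (t A.halt) (t A.halt)} ∪
    (Set.range (fun i => semiconjRelator (r i) (X ^ (A.M i).1) (X ^ (A.N i).1)) ∪
     Set.range (fun i => semiconjRelator (r i) (Y ^ (A.M i).2) (Y ^ (A.N i).2)) ∪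
     Set.range (fun i => semiconjRelator (r i) k k) ∪
     Set.range (fun i => semiconjRelator (r i)
      (conjBy X Y (t (A.src i)) (A.a i)) (conjBy X Y (t (A.tgt i)) (A.b i))))

theorem finite_relators : A.relators.Finite :=
  (Set.toFinite _).union ((((Set.finite_range _).union (Set.finite_range _)).union
    (Set.finite_range _)).union (Set.finite_range _))

theorem map_relators_eq_one {G : Type} [Group G] (φ : FreeGroup A.Gen →* G) :
    let X := φ (.of (.inl 0))
    let Y := φ (.of (.inl 1))
    let k := φ (.of (.inl 2))
    let t : A.Q → G := fun q => φ (.of (.inr (.inl q)))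
    let r : A.ι → G := fun i => φ (.of (.inr (.inr i)))
    (∀ x ∈ A.relators, φ x = 1) ↔ SemiconjBy X Y Y ∧ SemiconjBy k (t A.halt) (t A.halt) ∧
      (∀ i, SemiconjBy (r i) (X ^ (A.M i).1) (X ^ (A.N i).1)) ∧
      (∀ i, SemiconjBy (r i) (Y ^ (A.M i).2) (Y ^ (A.N i).2)) ∧
      (∀ i, SemiconjBy (r i) k k) ∧
      ∀ i, SemiconjBy (r i) (conjBy X Y (t (A.src i)) (A.a i))
        (conjBy X Y (t (A.tgt i)) (A.b i)) := by
  simp only [relators, Set.mem_union, Set.mem_insert_iff, Set.mem_singleton_iff, or_imp,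
    forall_and, forall_eq, Set.forall_mem_range, map_semiconjRelator_eq_one, map_conjBy, map_zpow,
    and_assoc]

theorem commute_conjBy {G : Type} [Group G] (φ : FreeGroup A.Gen →* G)
    (h : ∀ x ∈ A.relators, φ x = 1) {q : A.Q} {v : ℤ × ℤ} (hv : A.E q v) :
    Commute (φ (.of (.inl 2)))
      (φ (conjBy (.of (.inl 0)) (.of (.inl 1)) (.of (.inr (.inl q))) v)) := by
  obtain ⟨hXY, hk, hX, hY, hr, hT⟩ := (A.map_relators_eq_one φ).1 h
  refine A.E_induction (fun q v => Commute (φ (.of (.inl 2)))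
      (φ (conjBy (.of (.inl 0)) (.of (.inl 1)) (.of (.inr (.inl q))) v))) ?_ (fun i l => ?_) q v hv
  · rw [map_conjBy]
    simpa [conjBy, Commute] using hk
  · simp only [map_conjBy, conjBy_add hXY]
    have h1 : SemiconjBy (φ (.of (.inr (.inr i))))
        (φ (.of (.inl 0)) ^ (A.M i * l).1 * φ (.of (.inl 1)) ^ (A.M i * l).2)
        (φ (.of (.inl 0)) ^ (A.N i * l).1 * φ (.of (.inl 1)) ^ (A.N i * l).2) := by
      simp only [Prod.fst_mul, Prod.snd_mul, zpow_mul]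
      exact ((hX i).zpow_right _).mul_right ((hY i).zpow_right _)
    have h2 := (h1.inv_right.mul_right (hT i)).mul_right h1
    constructor
    · intro h3
      have h4 := (show Commute _ _ from hr i).symm.mul_right (h3.mul_right
        (show Commute _ _ from hr i).inv_left.symm)
      rwa [← mul_assoc, h2.eq, mul_inv_cancel_right] at h4
    · intro h3
      have h4 := (show Commute _ _ from hr i).inv_left.symm.mul_right
        (h3.mul_right (show Commute _ _ from hr i).symm)
      rwa [← h2.eq, inv_mul_cancel_left] at h4

theorem exists_hom_of_not_E : ∃ (G : Type) (_ : Group G) (φ : FreeGroup A.Gen →* G),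
    (∀ x ∈ A.relators, φ x = 1) ∧ ∀ q v, ¬ A.E q v → ∀ n : ℕ, 0 < n →
      φ (semiconjRelator (.of (.inl 2))
        (conjBy (.of (.inl 0)) (.of (.inl 1)) (.of (.inr (.inl q))) v)
        (conjBy (.of (.inl 0)) (.of (.inl 1)) (.of (.inr (.inl q))) v)) ^ n ≠ 1 := by
  have hinj : ∀ c : ℤ × ℤ, c.1 ≠ 0 ∧ c.2 ≠ 0 → Injective (AddMonoidHom.mulLeft c) := by
    intro c hc u v huv
    simp only [AddMonoidHom.coe_mulLeft, Prod.ext_iff, Prod.fst_mul, Prod.snd_mul,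
      mul_right_inj' hc.1, mul_right_inj' hc.2] at huv
    exact Prod.ext huv.1 huv.2
  obtain ⟨G, _, x, k, T, r, hT, hr, hk, hrT, hE, hE'⟩ := exists_perm_model A.E A.src A.tgt A.a A.b
    (fun i => AddMonoidHom.mulLeft (A.M i)) (fun i => AddMonoidHom.mulLeft (A.N i))
    (fun i => hinj _ (A.M_ne i)) (fun i => hinj _ (A.N_ne i)) A.E_iff
  let φ : FreeGroup A.Gen →* G := FreeGroup.lift (Sum.elim
    ![x (.ofAdd (1, 0)), x (.ofAdd (0, 1)), k] (Sum.elim (fun q => T q 0) r))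
  have hx : ∀ v : ℤ × ℤ, x (.ofAdd (1, 0)) ^ v.1 * x (.ofAdd (0, 1)) ^ v.2 = x (.ofAdd v) := by
    intro v
    rw [← map_zpow x, ← map_zpow x, ← map_mul x, ← ofAdd_zsmul, ← ofAdd_zsmul, ← ofAdd_add]
    congr 2
    ext <;> simp
  have hconj : ∀ q v, φ (conjBy (.of (.inl 0)) (.of (.inl 1)) (.of (.inr (.inl q))) v) = T q v := by
    intro q v
    rw [map_conjBy]
    simp only [φ, conjBy, FreeGroup.lift_apply_of, Sum.elim_inl, Sum.elim_inr, Matrix.cons_val_zero,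
      Matrix.cons_val_one, hx]
    rw [← map_inv, ← ofAdd_neg, ← hT, zero_add]
  refine ⟨G, inferInstance, φ, (A.map_relators_eq_one φ).2 ⟨?_, ?_, fun i => ?_, fun i => ?_,
    fun i => ?_, fun i => ?_⟩, fun q v hv n hn => ?_⟩
  · simp only [φ, FreeGroup.lift_apply_of, Sum.elim_inl, SemiconjBy, ← map_mul, Matrix.cons_val_zero,
      Matrix.cons_val_one]
    rw [mul_comm]
  · simpa [φ, SemiconjBy] using hE A.halt 0 A.E_halt
  · have h1 := hr i (1, 0)
    have h2 := hx (A.M i * (1, 0))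
    have h3 := hx (A.N i * (1, 0))
    simp at h2 h3
    simp [φ, SemiconjBy, h2, h3] at h1 ⊢
    exact h1
  · have h1 := hr i (0, 1)
    have h2 := hx (A.M i * (0, 1))
    have h3 := hx (A.N i * (0, 1))
    simp at h2 h3
    simp [φ, SemiconjBy, h2, h3] at h1 ⊢
    exact h1
  · simpa [φ, SemiconjBy] using hk i
  · rw [← map_conjBy, ← map_conjBy, hconj, hconj]
    simpa [φ, SemiconjBy] using hrT i
  · have h1 := hE' q v hv n hn
    rw [semiconjRelator]
    simp only [map_mul, map_inv, hconj]
    convert h1 using 2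
    simp [φ, mul_assoc]

end ModularMachine

theorem exists_simulation {p : ℕ → Prop} (hp : REPred p) :
    ∃ (β : Type) (_ : Fintype β) (S : Set (FreeGroup β)) (k t y : β) (N : ℕ → ℕ), S.Finite ∧
      Primrec N ∧ ∀ n,
      (p n → ∀ (G : Type) [Group G] (φ : FreeGroup β →* G), (∀ x ∈ S, φ x = 1) →
        φ (semiconjRelator (.of k) ((.of y ^ N n)⁻¹ * .of t * .of y ^ N n)
          ((.of y ^ N n)⁻¹ * .of t * .of y ^ N n)) = 1) ∧
      (¬ p n → ∃ (G : Type) (_ : Group G) (φ : FreeGroup β →* G), (∀ x ∈ S, φ x = 1) ∧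
        ∀ j : ℕ, 0 < j → φ (semiconjRelator (.of k) ((.of y ^ N n)⁻¹ * .of t * .of y ^ N n)
          ((.of y ^ N n)⁻¹ * .of t * .of y ^ N n)) ^ j ≠ 1) := by
  obtain ⟨Γ, Λ, _, _, _, _, T, c₀, c₁, c₂, hT⟩ := exists_turing_machine_of_rePred hp
  obtain ⟨A, b, code, hA⟩ := ModularMachine.exists_of_turing_machine T
  let N : ℕ → ℕ := fun n =>
    (c₀ :: c₁ :: List.replicate n c₂).foldr (fun g r => b * r + code g) 0
  have hN : Primrec N := by
    have hf : Primrec fun r : ℕ => b * r + code c₂ :=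
      Primrec.nat_add.comp (Primrec.nat_mul.comp (.const b) .id) (.const _)
    have h1 : Primrec fun n : ℕ =>
        Nat.rec (motive := fun _ => ℕ) 0 (fun _ r => b * r + code c₂) n :=
      Primrec.nat_rec₁ 0 (hf.comp Primrec.snd).to₂
    have h2 : Primrec fun n : ℕ => b * (b * Nat.rec (motive := fun _ => ℕ) 0
        (fun _ r => b * r + code c₂) n + code c₁) + code c₀ :=
      Primrec.nat_add.comp (Primrec.nat_mul.comp (.const b)
        (Primrec.nat_add.comp (Primrec.nat_mul.comp (.const b) h1) (.const _))) (.const _)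
    refine h2.of_eq fun n => ?_
    have h3 : ∀ n, (List.replicate n c₂).foldr (fun g r => b * r + code g) 0 =
        Nat.rec (motive := fun _ => ℕ) 0 (fun _ r => b * r + code c₂) n := by
      intro n
      induction n with
      | zero => rfl
      | succ n ih => rw [List.replicate_succ, List.foldr_cons, ih]
    simp only [N, List.foldr_cons, h3]
  have hconj : ∀ n : ℕ, (((FreeGroup.of (.inl 1 : A.Gen)) ^ n)⁻¹ * .of (.inr (.inl A.start)) *
      .of (.inl 1) ^ n) =
      conjBy (.of (.inl 0)) (.of (.inl 1)) (.of (.inr (.inl A.start))) (0, (n : ℤ)) := by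
    intro n
    simp [conjBy]
  refine ⟨A.Gen, inferInstance, A.relators, .inl 2, .inr (.inl A.start), .inl 1, N,
    A.finite_relators, hN, fun n => ?_⟩
  rw [← hT n, ← hA, hconj]
  constructor
  · intro hE G _ φ hφ
    exact (map_semiconjRelator_eq_one φ).2 (A.commute_conjBy φ hφ hE)
  · intro hE
    obtain ⟨G, _, φ, hφ, h⟩ := A.exists_hom_of_not_E
    exact ⟨G, inferInstance, φ, hφ, h _ _ hE⟩

end Simulation

section RabinConstruction

open Function

theorem exists_order_four_extension {β K : Type} [Group K] (f : β → K) (w : K)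
    (hw : ∀ j : ℕ, 0 < j → w ^ j ≠ 1) :
    ∃ (Γ : Type) (_ : Group Γ) (j : K →* Γ) (s : Γ) (x y : Option β → Γ),
      (∀ i, x i ^ 4 = 1) ∧ (∀ i, y i ^ 3 = 1) ∧ (∀ i, x i * y i = j w) ∧
      (∀ i, x i * j w ^ (-4 : ℤ) * (x i)⁻¹ = i.elim s fun h => j (f h) * s) ∧
      ∀ i, x i ^ 2 ≠ 1 := by
  obtain ⟨D, _, x, y, hx, hy, hx2, hD⟩ := exists_order_four_three
  have hzp : ∀ {H : Type} [Group H] (z : H), (∀ j : ℕ, 0 < j → z ^ j ≠ 1) →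
      Injective (zpowersHom H z) := by
    intro H _ z hz
    have h1 : Injective fun n : ℤ => z ^ n := injective_zpow_iff_not_isOfFinOrder.2 fun h => by
      obtain ⟨j, hj, h2⟩ := isOfFinOrder_iff_pow_eq_one.1 h
      exact hz j hj h2
    intro a b hab
    exact Multiplicative.toAdd.injective (h1 (by simpa [zpowersHom_apply] using hab))
  have hfree : ∀ j : ℕ, 0 < j → (FreeGroup.of true) ^ j ≠ 1 := by
    intro j hj h
    have h1 := congrArg (FreeGroup.lift fun _ : Bool => Multiplicative.ofAdd (1 : ℤ)) h
    simp only [map_pow, FreeGroup.lift_apply_of, map_one, ← ofAdd_nsmul] at h1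
    have h2 : j • (1 : ℤ) = 0 := h1
    simp at h2
    omega
  obtain ⟨K₁, _, jK, jF, -, hjF, hj⟩ := exists_amalgam (ι := Unit)
    (f := fun _ => zpowersHom K w) (fun _ => hzp w hw) (hzp _ hfree)
  have hjw : jK w = jF () (.of true) := by
    have h1 := hj () (.ofAdd 1)
    simpa [zpowersHom_apply] using h1
  let g : Option β → K₁ := fun i => i.elim 1 fun h => jK (f h)
  let σ : K₁ := jF () (.of false)
  let s₀ : Option β → K₁ := fun i => (g i)⁻¹ * σ
  let diag : K₁ →* (Option β → K₁) := Pi.constMonoidHom _ _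
  let F : Option β → FreeGroup Bool →* (Option β → K₁) := fun i =>
    FreeGroup.lift fun b => if b then diag (jK w) else diag (g i) * s₀
  have hF : ∀ i, Injective (F i) := by
    intro i
    have h1 : (Pi.evalMonoidHom _ i).comp (F i) = jF () := by
      ext b
      cases b
      · simp [F, diag, s₀, σ]
      · simp [F, diag, hjw]
    have h2 : Injective ((Pi.evalMonoidHom _ i).comp (F i)) := h1 ▸ hjF ()
    exact Injective.of_comp (f := Pi.evalMonoidHom (fun _ : Option β => K₁) i) h2
  obtain ⟨Γ, _, jG, jH, -, hjH, hΓ⟩ := exists_amalgam hF hD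
  have hxy : ∀ i, jH i (x * y) = jG (diag (jK w)) := by
    intro i
    simpa [F] using (hΓ i (.of true)).symm
  refine ⟨Γ, inferInstance, jG.comp (diag.comp jK), jG s₀, fun i => jH i x, fun i => jH i y,
    fun i => ?_, fun i => ?_, fun i => ?_, fun i => ?_, fun i h => ?_⟩
  · rw [← map_pow, hx, map_one]
  · rw [← map_pow, hy, map_one]
  · rw [← map_mul, hxy]
    rfl
  · have h1 := hΓ i (.of false)
    simp only [F, FreeGroup.lift_apply_of, Bool.false_eq_true, if_false, map_mul, map_zpow,
      map_inv] at h1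
    have h2 := hxy i
    rw [map_mul] at h2
    rw [h2] at h1
    refine Eq.trans h1.symm ?_
    rcases i with _ | h
    · simp [g]
    · simp [g]
  · exact hx2 (hjH i (by rw [map_pow, h, map_one]))

/-- The generators of the Rabin group over `β`. -/
abbrev RabinGen (β : Type) : Type := (β ⊕ Bool) ⊕ Option β × Bool

/-- The relators of the Rabin group, over relators `S` on `β`. -/
def rabinRelators {β : Type} (S : Set (FreeGroup β)) : Set (FreeGroup (RabinGen β)) :=
  let w : FreeGroup (RabinGen β) := .of (.inl (.inr true))
  let s : FreeGroup (RabinGen β) := .of (.inl (.inr false))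
  let x : Option β → FreeGroup (RabinGen β) := fun i => .of (.inr (i, true))
  let y : Option β → FreeGroup (RabinGen β) := fun i => .of (.inr (i, false))
  FreeGroup.map (fun h => .inl (.inl h)) '' S ∪
    (Set.range (fun i => x i ^ 4) ∪ Set.range (fun i => y i ^ 3) ∪
     Set.range (fun i => x i * y i * w⁻¹) ∪
     Set.range (fun i => x i * w ^ (-4 : ℤ) * (x i)⁻¹ *
      (i.elim s fun h => .of (.inl (.inl h)) * s)⁻¹))

theorem finite_rabinRelators {β : Type} [Fintype β] {S : Set (FreeGroup β)} (hS : S.Finite) :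
    (rabinRelators S).Finite :=
  (hS.image _).union ((((Set.finite_range _).union (Set.finite_range _)).union
    (Set.finite_range _)).union (Set.finite_range _))

theorem map_rabinRelators_eq_one {β G : Type} [Group G] (S : Set (FreeGroup β))
    (φ : FreeGroup (RabinGen β) →* G) :
    let w := φ (.of (.inl (.inr true)))
    let s := φ (.of (.inl (.inr false)))
    let x : Option β → G := fun i => φ (.of (.inr (i, true)))
    let y : Option β → G := fun i => φ (.of (.inr (i, false)))
    (∀ r ∈ rabinRelators S, φ r = 1) ↔
      (∀ r ∈ S, φ (FreeGroup.map (fun h => .inl (.inl h)) r) = 1) ∧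
      (∀ i, x i ^ 4 = 1) ∧ (∀ i, y i ^ 3 = 1) ∧ (∀ i, x i * y i = w) ∧
      ∀ i, x i * w ^ (-4 : ℤ) * (x i)⁻¹ = i.elim s fun h => φ (.of (.inl (.inl h))) * s := by
  have h1 : ∀ (i : Option β) (s : FreeGroup (RabinGen β)) (f : β → FreeGroup (RabinGen β)),
      φ (i.elim s f) = i.elim (φ s) fun h => φ (f h) := by
    rintro (_ | _) <;> simp
  simp only [rabinRelators, Set.mem_union, or_imp, forall_and, Set.forall_mem_range,
    Set.forall_mem_image, and_assoc, map_mul, map_inv, map_pow, map_zpow, mul_inv_eq_one, h1]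

theorem eq_one_of_rabinRelators {β G : Type} [Group G] (S : Set (FreeGroup β))
    (φ : FreeGroup (RabinGen β) →* G) (hφ : ∀ r ∈ rabinRelators S, φ r = 1)
    (hw : φ (.of (.inl (.inr true))) = 1) : φ = 1 := by
  obtain ⟨-, hx, hy, hxy, hs⟩ := (map_rabinRelators_eq_one S φ).1 hφ
  simp only [hw] at hxy hs
  have hy1 : ∀ i, φ (.of (.inr (i, false))) = (φ (.of (.inr (i, true))))⁻¹ :=
    fun i => (inv_eq_of_mul_eq_one_right (hxy i)).symm
  have hx1 : ∀ i, φ (.of (.inr (i, true))) = 1 := by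
    intro i
    have h1 : φ (.of (.inr (i, false))) ^ 3 = 1 := hy i
    rw [hy1, inv_pow, inv_eq_one] at h1
    have h2 : φ (.of (.inr (i, true))) ^ 4 = 1 := hx i
    rwa [pow_succ, h1, one_mul] at h2
  have hs1 : φ (.of (.inl (.inr false))) = 1 := by
    simpa [hx1] using (hs none).symm
  ext d
  rcases d with (h | _ | _) | ⟨i, _ | _⟩
  · simpa [hx1, hs1] using (hs (some h)).symm
  · exact hs1
  · exact hw
  · simp [hy1, hx1]
  · exact hx1 i

theorem exists_torsion_or_trivial {p : ℕ → Prop} (hp : REPred p) :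
    ∃ (δ : Type) (_ : Fintype δ) (S : Set (FreeGroup δ)) (w k t y x : δ) (N : ℕ → ℕ), S.Finite ∧
      Primrec N ∧ FreeGroup.of x ^ 4 ∈ S ∧ ∀ n,
      (p n → ∀ (G : Type) [Group G] (φ : FreeGroup δ →* G), (∀ r ∈ S, φ r = 1) →
        φ (.of w) = φ (semiconjRelator (.of k) ((.of y ^ N n)⁻¹ * .of t * .of y ^ N n)
          ((.of y ^ N n)⁻¹ * .of t * .of y ^ N n)) → φ = 1) ∧
      (¬ p n → ∃ (G : Type) (_ : Group G) (φ : FreeGroup δ →* G), (∀ r ∈ S, φ r = 1) ∧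
        φ (.of w) = φ (semiconjRelator (.of k) ((.of y ^ N n)⁻¹ * .of t * .of y ^ N n)
          ((.of y ^ N n)⁻¹ * .of t * .of y ^ N n)) ∧ φ (.of x) ^ 2 ≠ 1) := by
  obtain ⟨β, _, S, k, t, y, N, hS, hN, h⟩ := exists_simulation hp
  have hmap : ∀ n : ℕ, semiconjRelator (.of (.inl (.inl k) : RabinGen β))
      ((.of (.inl (.inl y)) ^ n)⁻¹ * .of (.inl (.inl t)) * .of (.inl (.inl y)) ^ n)
      ((.of (.inl (.inl y)) ^ n)⁻¹ * .of (.inl (.inl t)) * .of (.inl (.inl y)) ^ n) =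
      FreeGroup.map (fun h => .inl (.inl h)) (semiconjRelator (.of k)
        ((.of y ^ n)⁻¹ * .of t * .of y ^ n) ((.of y ^ n)⁻¹ * .of t * .of y ^ n)) := by
    intro n
    simp [semiconjRelator]
  refine ⟨RabinGen β, inferInstance, rabinRelators S, .inl (.inr true), .inl (.inl k),
    .inl (.inl t), .inl (.inl y), .inr (none, true), N, finite_rabinRelators hS, hN, ?_,
    fun n => ⟨fun hn G _ φ hφ hw => ?_, fun hn => ?_⟩⟩
  · exact Or.inr (Or.inl (Or.inl (Or.inl ⟨none, rfl⟩)))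
  · refine eq_one_of_rabinRelators S φ hφ ?_
    rw [hw, hmap]
    exact (h n).1 hn G (φ.comp (FreeGroup.map _)) ((map_rabinRelators_eq_one S φ).1 hφ).1
  · obtain ⟨K, _, ψ, hψ, hpow⟩ := (h n).2 hn
    obtain ⟨Γ, _, j, s, x, y', hx, hy, hxy, hs, hx2⟩ :=
      exists_order_four_extension (fun h => ψ (.of h)) _ hpow
    let φ : FreeGroup (RabinGen β) →* Γ := FreeGroup.lift (Sum.elim
      (Sum.elim (fun h => j (ψ (.of h))) fun b => if b then j (ψ (semiconjRelator (.of k)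
        ((.of y ^ N n)⁻¹ * .of t * .of y ^ N n) ((.of y ^ N n)⁻¹ * .of t * .of y ^ N n))) else s)
      fun z => if z.2 then x z.1 else y' z.1)
    have hφ : φ.comp (FreeGroup.map fun h => .inl (.inl h)) = j.comp ψ := by
      ext h
      simp [φ]
    refine ⟨Γ, inferInstance, φ, (map_rabinRelators_eq_one S φ).2 ⟨fun r hr => ?_, ?_, ?_, ?_, ?_⟩,
      ?_, ?_⟩
    · change φ.comp (FreeGroup.map fun h => .inl (.inl h)) r = 1
      rw [hφ, MonoidHom.comp_apply, hψ r hr, map_one]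
    · simpa [φ] using hx
    · simpa [φ] using hy
    · simpa [φ] using hxy
    · simpa [φ] using hs
    · rw [hmap]
      change _ = φ.comp (FreeGroup.map fun h => .inl (.inl h)) _
      rw [hφ]
      simp only [φ, FreeGroup.lift_apply_of, Sum.elim_inl, Sum.elim_inr, if_true,
        MonoidHom.comp_apply]
    · simpa [φ] using hx2 none

end RabinConstruction

section FinitePresentationFamily

theorem FinPres.map_rels_eq_one {G : Type*} [Group G] {m : ℕ} {R : List (Word m)}
    (φ : FreeGroup (Fin m) →* G) :
    (∀ x ∈ FinPres.rels ⟨m, R⟩, φ x = 1) ↔ ∀ r ∈ R, φ (FreeGroup.mk r) = 1 :=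
  ⟨fun h r hr => h _ ⟨r, hr, rfl⟩, by rintro h _ ⟨r, hr, rfl⟩; exact h r hr⟩

theorem FreeGroup.mk_replicate {α : Type*} (a : α) (b : Bool) (n : ℕ) :
    FreeGroup.mk (List.replicate n (a, b)) = FreeGroup.mk [(a, b)] ^ n := by
  induction n with
  | zero => rfl
  | succ n ih => rw [List.replicate_succ, pow_succ', ← ih, FreeGroup.mul_mk]; rfl

theorem primrec_replicate {α : Type*} [Primcodable α] (a : α) :
    Primrec fun n : ℕ => List.replicate n a :=
  (Primrec.list_map Primrec.list_range (Primrec.const a).to₂).of_eq fun n => by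
    simp [List.map_const']

/-- A word representing `w⁻¹ * [k, y⁻ⁿ t yⁿ]`. -/
def commutatorWord {m : ℕ} (w k t y : Fin m) (n : ℕ) : Word m :=
  let c : Bool → Word m := fun b =>
    List.replicate n (y, false) ++ ((t, b) :: List.replicate n (y, true))
  (w, false) :: (k, true) :: (c true ++ ((k, false) :: c false))

theorem primrec_commutatorWord {m : ℕ} (w k t y : Fin m) : Primrec (commutatorWord w k t y) := by
  have h1 : ∀ b, Primrec fun n : ℕ =>
      List.replicate n (y, false) ++ ((t, b) :: List.replicate n (y, true)) := fun b =>
    Primrec.list_append.comp (primrec_replicate _)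
      (Primrec.list_cons.comp (.const _) (primrec_replicate _))
  exact Primrec.list_cons.comp (.const _) (Primrec.list_cons.comp (.const _)
    (Primrec.list_append.comp (h1 true) (Primrec.list_cons.comp (.const _) (h1 false))))

theorem mk_commutatorWord {m : ℕ} (w k t y : Fin m) (n : ℕ) :
    FreeGroup.mk (commutatorWord w k t y n) = (.of w)⁻¹ *
      semiconjRelator (.of k) ((.of y ^ n)⁻¹ * .of t * .of y ^ n)
        ((.of y ^ n)⁻¹ * .of t * .of y ^ n) := by
  have hcons : ∀ (z : Fin m × Bool) (l : Word m),
      FreeGroup.mk (z :: l) = FreeGroup.mk [z] * FreeGroup.mk l := fun z l => by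
    rw [FreeGroup.mul_mk]; rfl
  have hfalse : ∀ a : Fin m, FreeGroup.mk [(a, false)] = (FreeGroup.of a)⁻¹ := fun a => rfl
  have htrue : ∀ a : Fin m, FreeGroup.mk [(a, true)] = FreeGroup.of a := fun a => rfl
  simp only [commutatorWord, semiconjRelator, hcons (_, _) (_ :: _), hcons (_, _) (_ ++ _),
    ← FreeGroup.mul_mk, hcons (_, _) (List.replicate _ _), FreeGroup.mk_replicate, hfalse, htrue]
  group

theorem exists_finPres_family {p : ℕ → Prop} (hp : REPred p) :
    ∃ (m : ℕ) (R : ℕ → List (Word m)), Primrec R ∧ ∀ n,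
      (p n → ∀ x : FinPres.Grp ⟨m, R n⟩, x = 1) ∧
      (¬ p n → ∃ x : FinPres.Grp ⟨m, R n⟩, orderOf x = 2) := by
  classical
  obtain ⟨δ, _, S, w, k, t, y, x, N, hS, hN, hx, h⟩ := exists_torsion_or_trivial hp
  let e := Fintype.equivFin δ
  let R₀ : List (Word (Fintype.card δ)) :=
    hS.toFinset.toList.map fun r => (FreeGroup.map e r).toWord
  let R : ℕ → List (Word (Fintype.card δ)) := fun n =>
    commutatorWord (e w) (e k) (e t) (e y) (N n) :: R₀
  have hR : ∀ (n : ℕ) {G : Type} [Group G] (φ : FreeGroup (Fin (Fintype.card δ)) →* G),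
      (∀ z ∈ FinPres.rels ⟨_, R n⟩, φ z = 1) ↔
        (∀ r ∈ S, φ.comp (FreeGroup.map e) r = 1) ∧ φ.comp (FreeGroup.map e) (.of w) =
          φ.comp (FreeGroup.map e) (semiconjRelator (.of k)
            ((.of y ^ N n)⁻¹ * .of t * .of y ^ N n) ((.of y ^ N n)⁻¹ * .of t * .of y ^ N n)) := by
    intro n G _ φ
    rw [FinPres.map_rels_eq_one]
    have h2 : (φ.comp (FreeGroup.map e)) (semiconjRelator (.of k)
        ((.of y ^ N n)⁻¹ * .of t * .of y ^ N n) ((.of y ^ N n)⁻¹ * .of t * .of y ^ N n)) =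
        φ (semiconjRelator (.of (e k)) ((.of (e y) ^ N n)⁻¹ * .of (e t) * .of (e y) ^ N n)
          ((.of (e y) ^ N n)⁻¹ * .of (e t) * .of (e y) ^ N n)) := by
      simp [semiconjRelator]
    rw [h2]
    simp only [R, R₀, List.forall_mem_cons, mk_commutatorWord, map_mul φ (_)⁻¹, map_inv,
      inv_mul_eq_one, List.forall_mem_map, Finset.mem_toList, Set.Finite.mem_toFinset,
      FreeGroup.mk_toWord, MonoidHom.comp_apply, FreeGroup.map.of]
    exact and_comm
  refine ⟨Fintype.card δ, R, Primrec.list_cons.comp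
    ((primrec_commutatorWord _ _ _ _).comp hN) (.const R₀), fun n => ⟨fun hn z => ?_, fun hn => ?_⟩⟩
  · obtain ⟨z, rfl⟩ := PresentedGroup.mk_surjective _ z
    obtain ⟨h1, h2⟩ := (hR n (PresentedGroup.mk (FinPres.rels ⟨_, R n⟩))).1
      fun z hz => PresentedGroup.one_of_mem hz
    have h3 := (h n).1 hn _ _ h1 h2
    have h4 := DFunLike.congr_fun h3 (FreeGroup.map e.symm z)
    rw [MonoidHom.comp_apply, FreeGroup.map.comp, e.self_comp_symm, FreeGroup.map.id] at h4
    exact h4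
  · obtain ⟨G, _, φ, h1, h2, h3⟩ := (h n).2 hn
    let ψ : FreeGroup (Fin (Fintype.card δ)) →* G := φ.comp (FreeGroup.map e.symm)
    have hψ : ψ.comp (FreeGroup.map e) = φ := by
      ext d
      simp [ψ]
    have h4 : ∀ z ∈ FinPres.rels ⟨_, R n⟩, ψ z = 1 := (hR n ψ).2 (by rw [hψ]; exact ⟨h1, h2⟩)
    refine ⟨PresentedGroup.mk _ (.of (e x)) ^ 2, orderOf_eq_prime ?_ fun h5 => h3 ?_⟩
    · have h6 := ((hR n (PresentedGroup.mk (FinPres.rels ⟨_, R n⟩))).1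
        fun z hz => PresentedGroup.one_of_mem hz).1 _ hx
      rw [← pow_mul]
      simpa using h6
    · have h6 : ∀ z ∈ FinPres.rels ⟨_, R n⟩, FreeGroup.lift (fun i => ψ (.of i)) z = 1 := by
        have h7 : FreeGroup.lift (fun i => ψ (.of i)) = ψ := by ext; simp
        rw [h7]
        exact h4
      have h8 := congrArg (PresentedGroup.toGroup h6) h5
      rw [map_pow, map_one] at h8
      change (PresentedGroup.toGroup h6 (PresentedGroup.of (e x))) ^ 2 = 1 at h8
      simpa [ψ] using h8

end FinitePresentationFamily

section FreeProductTorsion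

namespace Monoid.CoprodI

variable {ι : Type*} {G : ι → Type*} [∀ i, Group (G i)]

/-- A list of letters is reduced if no letter is trivial and neighbours lie in different factors. -/
def IsReduced (l : List (Σ i, G i)) : Prop :=
  (∀ a ∈ l, a.2 ≠ 1) ∧ l.IsChain fun a b => a.1 ≠ b.1

/-- The product of a list of letters. -/
def listProd (l : List (Σ i, G i)) : CoprodI G := (l.map fun a => of a.2).prod

theorem exists_isReduced (z : CoprodI G) : ∃ l : List (Σ i, G i), IsReduced l ∧ listProd l = z := by
  classical
  obtain ⟨w, rfl⟩ := Word.equiv.symm.surjective z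
  exact ⟨w.toList, ⟨fun a ha => w.ne_one a ha, w.chain_ne⟩, rfl⟩

theorem IsReduced.eq_nil {l : List (Σ i, G i)} (hl : IsReduced l) (h : listProd l = 1) :
    l = [] := by
  classical
  let w : Word G := ⟨l, fun a ha => hl.1 a ha, hl.2⟩
  have h1 : w = Word.empty := Word.equiv.symm.injective (by
    change w.prod = Word.empty.prod
    rw [Word.prod_empty]
    exact h)
  exact congrArg Word.toList h1

theorem IsReduced.eq_nil_of_pow {l : List (Σ i, G i)} (hl : IsReduced l)
    (hne : ∀ a ∈ l.getLast?, ∀ b ∈ l.head?, a.1 ≠ b.1) {n : ℕ} (hn : 0 < n)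
    (h : listProd l ^ n = 1) : l = [] := by
  by_contra hl0
  have h1 : IsReduced (List.replicate n l).flatten := by
    refine ⟨fun a ha => ?_, ?_⟩
    · obtain ⟨l', hl', ha'⟩ := List.mem_flatten.1 ha
      rw [List.eq_of_mem_replicate hl'] at ha'
      exact hl.1 a ha'
    · refine (List.isChain_flatten fun h2 => hl0 (List.eq_of_mem_replicate h2).symm).2 ⟨?_, ?_⟩
      · intro l' hl'
        rw [List.eq_of_mem_replicate hl']
        exact hl.2
      · exact List.isChain_replicate_of_rel n fun a ha b hb => hne a ha b hb
  have h2 : listProd (List.replicate n l).flatten = listProd l ^ n := by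
    simp [listProd, List.map_flatten, List.prod_flatten]
  have h3 := h1.eq_nil (h2.trans h)
  rw [List.flatten_eq_nil_iff] at h3
  exact hl0 (h3 l (List.mem_replicate.2 ⟨hn.ne', rfl⟩))

theorem IsReduced.exists_isConj [Nonempty ι] {n : ℕ} (hn : 0 < n) (l : List (Σ i, G i))
    (hl : IsReduced l) (h : listProd l ^ n = 1) :
    ∃ (i : ι) (g : G i), IsConj (of g) (listProd l) := by
  induction hk : l.length using Nat.strong_induction_on generalizing l with
  | _ k ih =>
  rcases l with _ | ⟨⟨i, g⟩, t⟩
  · exact ⟨Classical.arbitrary ι, 1, by simp [listProd]⟩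
  rcases List.eq_nil_or_concat' t with rfl | ⟨mid, ⟨j, x⟩, rfl⟩
  · exact ⟨i, g, by rw [listProd, List.map_singleton, List.prod_singleton]⟩
  by_cases hij : j = i
  · subst hij
    have hconj : IsConj (listProd (⟨j, x * g⟩ :: mid)) (listProd (⟨j, g⟩ :: (mid ++ [⟨j, x⟩]))) :=
      isConj_iff.2 ⟨(of x)⁻¹, by simp [listProd, mul_assoc]⟩
    have hred : IsReduced mid := ⟨fun a ha => hl.1 a (by simp [ha]),
      (List.isChain_append.1 (List.isChain_cons.1 hl.2).2).1⟩
    have hpow : listProd (⟨j, x * g⟩ :: mid) ^ n = 1 := by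
      obtain ⟨c, hc⟩ := isConj_iff.1 hconj
      rw [← hc, conj_pow] at h
      simpa using h
    by_cases hxg : x * g = 1
    · have h1 : listProd (⟨j, x * g⟩ :: mid) = listProd mid := by simp [listProd, hxg]
      rw [h1] at hconj hpow
      obtain ⟨i, g', hg'⟩ := ih mid.length (by rw [← hk]; simp) mid hred hpow rfl
      exact ⟨i, g', hg'.trans hconj⟩
    · have h2 : IsReduced (⟨j, x * g⟩ :: mid) := by
        refine ⟨?_, ?_⟩
        · simp only [List.mem_cons, forall_eq_or_imp]
          exact ⟨hxg, hred.1⟩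
        · refine List.isChain_cons.2 ⟨fun b hb => ?_, hred.2⟩
          refine (List.isChain_cons.1 hl.2).1 b ?_
          rw [List.head?_append]
          rw [Option.mem_def.1 hb]
          rfl
      refine absurd (h2.eq_nil_of_pow ?_ hn hpow) (by simp)
      intro a ha b hb
      simp only [List.head?_cons, Option.mem_def, Option.some.injEq] at hb
      subst hb
      rcases List.eq_nil_or_concat' mid with rfl | ⟨mid', c, rfl⟩
      · exact absurd rfl ((List.isChain_cons.1 hl.2).1 ⟨j, x⟩ (by simp))
      · have h3 := (List.isChain_append.1 (List.isChain_cons.1 hl.2).2).2.2 a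
          (by simpa [List.getLast?_cons] using ha) ⟨j, x⟩ (by simp)
        exact h3
  · refine absurd (hl.eq_nil_of_pow ?_ hn h) (by simp)
    intro a ha b hb
    simp only [List.head?_cons, Option.mem_def, Option.some.injEq] at hb
    subst hb
    have h3 : a = ⟨j, x⟩ := by
      simpa [List.getLast?_cons, eq_comm] using ha
    rw [h3]
    exact hij

/-- Elements of finite order of a free product are conjugate into a factor. -/
theorem exists_isConj_of_isOfFinOrder [Nonempty ι] {z : CoprodI G} (hz : IsOfFinOrder z) :
    ∃ (i : ι) (g : G i), IsConj (of g) z := by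
  obtain ⟨l, hl, rfl⟩ := exists_isReduced z
  obtain ⟨n, hn, h⟩ := isOfFinOrder_iff_pow_eq_one.1 hz
  exact hl.exists_isConj hn l h

end Monoid.CoprodI

namespace Monoid.Coprod

theorem fst_eq_one_or_snd_eq_one_of_family {F : Bool → Type*} [∀ b, Group (F b)]
    {z : Coprod (F false) (F true)} (hz : IsOfFinOrder z) : fst z = 1 ∨ snd z = 1 := by
  let ψ : Coprod (F false) (F true) →* CoprodI F := lift CoprodI.of CoprodI.of
  let π : (b : Bool) → CoprodI F →* F b := fun b => CoprodI.lift (Pi.mulSingle b (MonoidHom.id _))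
  have h₁ : (π false).comp ψ = fst := by
    refine hom_ext ?_ ?_ <;> ext x <;> simp [π, ψ]
  have h₂ : (π true).comp ψ = snd := by
    refine hom_ext ?_ ?_ <;> ext x <;> simp [π, ψ]
  obtain ⟨b, g, hg⟩ := CoprodI.exists_isConj_of_isOfFinOrder (ψ.isOfFinOrder hz)
  rw [← h₁, ← h₂]
  cases b
  · right
    simpa [π, eq_comm] using (π true).map_isConj hg
  · left
    simpa [π, eq_comm] using (π false).map_isConj hg

theorem fst_eq_one_or_snd_eq_one {G H : Type} [Group G] [Group H] {z : Coprod G H}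
    (hz : IsOfFinOrder z) : fst z = 1 ∨ snd z = 1 :=
  let _ : ∀ b : Bool, Group (cond b H G : Type) := fun b => match b with
    | false => inferInstanceAs (Group G)
    | true => inferInstanceAs (Group H)
  fst_eq_one_or_snd_eq_one_of_family (F := fun b => cond b H G) hz

end Monoid.Coprod

end FreeProductTorsion

section WordProblem

theorem REPred.exists_of_primrec {α β : Type*} [Primcodable α] [Primcodable β] {f : α → β → Bool}
    (hf : Primrec₂ f) : REPred fun a => ∃ b, f a b = true := by
  have h1 : Primrec₂ fun (a : α) (n : ℕ) => (Encodable.decode (α := β) n).bind fun b =>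
      if f a b = true then some () else none := by
    refine Primrec.option_bind (Primrec.decode.comp Primrec.snd) ?_
    exact Primrec.ite (Primrec.eq.comp (hf.comp (Primrec.fst.comp Primrec.fst) Primrec.snd)
      (.const true)) (.const _) (.const _)
  refine (Partrec.rfindOpt h1.to_comp).dom_re.of_eq fun a => ?_
  rw [Nat.rfindOpt_dom]
  constructor
  · rintro ⟨n, _, hn⟩
    obtain ⟨b, -, hb⟩ := Option.bind_eq_some_iff.1 hn
    refine ⟨b, ?_⟩
    by_contra h
    simp [h] at hb
  · rintro ⟨b, hb⟩
    exact ⟨Encodable.encode b, (), by simp [hb]⟩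

variable {m : ℕ}

theorem primrec_invRev : Primrec (FreeGroup.invRev : Word m → Word m) :=
  Primrec.list_reverse.comp (Primrec.list_map .id ((Primrec.pair (Primrec.fst.comp Primrec.snd)
    (Primrec.not.comp (Primrec.snd.comp Primrec.snd))).to₂))

theorem primrec_reduce : Primrec (FreeGroup.reduce : Word m → Word m) := by
  have h1 : Primrec₂ fun (x : (Fin m × Bool) × Word m) (z : (Fin m × Bool) × Word m) =>
      if x.1.1 = z.1.1 ∧ x.1.2 = !z.1.2 then z.2 else x.1 :: z.1 :: z.2 := by
    have hx : Primrec fun a : ((Fin m × Bool) × Word m) × ((Fin m × Bool) × Word m) => a.1.1 :=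
      Primrec.fst.comp Primrec.fst
    have hz : Primrec fun a : ((Fin m × Bool) × Word m) × ((Fin m × Bool) × Word m) => a.2.1 :=
      Primrec.fst.comp Primrec.snd
    refine Primrec.ite (PrimrecPred.and
      (Primrec.eq.comp (Primrec.fst.comp hx) (Primrec.fst.comp hz))
      (Primrec.eq.comp (Primrec.snd.comp hx) (Primrec.not.comp (Primrec.snd.comp hz))))
      (Primrec.snd.comp Primrec.snd) ?_
    exact Primrec.list_cons.comp hx (Primrec.list_cons.comp hz (Primrec.snd.comp Primrec.snd))
  have h2 : Primrec fun x : (Fin m × Bool) × Word m => (List.casesOn x.2 [x.1] fun hd tl =>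
      if x.1.1 = hd.1 ∧ x.1.2 = !hd.2 then tl else x.1 :: hd :: tl : Word m) :=
    Primrec.list_casesOn Primrec.snd (Primrec.list_cons.comp Primrec.fst (.const [])) h1
  refine (Primrec.list_foldr .id (.const []) (h2.comp Primrec.snd).to₂).of_eq fun l => ?_
  induction l with
  | nil => rfl
  | cons a l ih =>
    rw [FreeGroup.reduce.cons, ← ih]
    rfl

/-- The word spelled out by a certificate, a list of conjugates of relators and their inverses. -/
def certificateWord (R : List (Word m)) (c : List (Word m × ℕ × Bool)) : Word m :=
  c.flatMap fun z =>
    z.1 ++ ((if z.2.2 = true then R.getD z.2.1 [] else FreeGroup.invRev (R.getD z.2.1 [])) ++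
      FreeGroup.invRev z.1)

theorem primrec_certificateWord : Primrec₂ (certificateWord (m := m)) := by
  have hz : Primrec fun a : (List (Word m) × List (Word m × ℕ × Bool)) × (Word m × ℕ × Bool) =>
      a.2 := Primrec.snd
  have hr : Primrec fun a : (List (Word m) × List (Word m × ℕ × Bool)) × (Word m × ℕ × Bool) =>
      a.1.1.getD a.2.2.1 [] := (Primrec.list_getD []).comp (Primrec.fst.comp Primrec.fst)
        (Primrec.fst.comp (Primrec.snd.comp hz))
  refine Primrec.list_flatMap Primrec.snd ?_
  exact Primrec.list_append.comp (Primrec.fst.comp hz) (Primrec.list_append.comp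
    (Primrec.ite (Primrec.eq.comp (Primrec.snd.comp (Primrec.snd.comp hz)) (.const true)) hr
      (primrec_invRev.comp hr)) (primrec_invRev.comp (Primrec.fst.comp hz)))

theorem mk_certificateWord_append (R : List (Word m)) (c d : List (Word m × ℕ × Bool)) :
    FreeGroup.mk (certificateWord R (c ++ d)) =
      FreeGroup.mk (certificateWord R c) * FreeGroup.mk (certificateWord R d) := by
  rw [FreeGroup.mul_mk]
  simp [certificateWord]

theorem mk_certificateWord_singleton (R : List (Word m)) (u : Word m) (i : ℕ) (b : Bool) :
    FreeGroup.mk (certificateWord R [(u, i, b)]) = FreeGroup.mk u *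
      (if b = true then FreeGroup.mk (R.getD i []) else (FreeGroup.mk (R.getD i []))⁻¹) *
      (FreeGroup.mk u)⁻¹ := by
  simp only [certificateWord, List.flatMap_cons, List.flatMap_nil, List.append_nil,
    ← FreeGroup.mul_mk, ← FreeGroup.inv_mk]
  split <;> simp [FreeGroup.inv_mk]

theorem exists_certificate_iff (R : List (Word m)) (x : FreeGroup (Fin m)) :
    (∃ c, FreeGroup.mk (certificateWord R c) = x) ↔ FinPres.proj ⟨m, R⟩ x = 1 := by
  constructor
  · rintro ⟨c, rfl⟩
    induction c with
    | nil => exact map_one _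
    | cons z c ih =>
      obtain ⟨u, i, b⟩ := z
      have h1 : FinPres.proj ⟨m, R⟩ (FreeGroup.mk (R.getD i [])) = 1 := by
        rcases lt_or_ge i R.length with hi | hi
        · rw [List.getD_eq_getElem _ _ hi]
          exact PresentedGroup.one_of_mem ⟨_, List.getElem_mem hi, rfl⟩
        · rw [List.getD_eq_default _ _ hi]
          exact map_one _
      rw [← List.singleton_append, mk_certificateWord_append, map_mul, ih,
        mk_certificateWord_singleton, map_mul, map_mul, map_inv]
      split <;> rw [mul_one, mul_inv_eq_one, mul_eq_left] <;> simp only [map_inv, h1, inv_one]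
  · intro h
    have h1 : x ∈ Subgroup.normalClosure (FinPres.rels ⟨m, R⟩) := PresentedGroup.mk_eq_one_iff.1 h
    rw [Subgroup.normalClosure, ← Subgroup.mem_toSubmonoid, Subgroup.closure_toSubmonoid] at h1
    have h2 : ∀ (z : FreeGroup (Fin m)) (b : Bool),
        z ∈ Group.conjugatesOfSet (FinPres.rels ⟨m, R⟩) →
        ∃ c, FreeGroup.mk (certificateWord R c) = if b = true then z else z⁻¹ := by
      intro z b hz
      obtain ⟨_, ⟨r, hr, rfl⟩, hz⟩ := Group.mem_conjugatesOfSet_iff.1 hz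
      obtain ⟨u, rfl⟩ := isConj_iff.1 hz
      obtain ⟨i, hi, rfl⟩ := List.getElem_of_mem hr
      refine ⟨[(u.toWord, i, b)], ?_⟩
      rw [mk_certificateWord_singleton, List.getD_eq_getElem _ _ hi, FreeGroup.mk_toWord]
      cases b
      · simp [mul_assoc]
      · rfl
    clear h
    induction h1 using Submonoid.closure_induction with
    | mem z hz =>
      rcases hz with hz | hz
      · exact h2 z true hz
      · simpa using h2 _ false hz
    | one => exact ⟨[], rfl⟩
    | mul y z _ _ hy hz =>
      obtain ⟨c, hc⟩ := hy
      obtain ⟨d, hd⟩ := hz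
      exact ⟨c ++ d, by rw [mk_certificateWord_append, hc, hd]⟩

theorem rePred_proj_eq_one :
    REPred fun z : List (Word m) × Word m => FinPres.proj ⟨m, z.1⟩ (FreeGroup.mk z.2) = 1 := by
  have h1 : Primrec₂ fun (z : List (Word m) × Word m) (c : List (Word m × ℕ × Bool)) =>
      decide (FreeGroup.reduce (certificateWord z.1 c) = FreeGroup.reduce z.2) := by
    refine PrimrecPred.decide (Primrec.eq.comp (primrec_reduce.comp
      (primrec_certificateWord.comp (Primrec.fst.comp Primrec.fst) Primrec.snd))
      (primrec_reduce.comp (Primrec.snd.comp Primrec.fst)))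
  refine (REPred.exists_of_primrec h1).of_eq fun z => ?_
  rw [← exists_certificate_iff]
  simp only [decide_eq_true_eq]
  exact exists_congr fun c => ⟨FreeGroup.reduce.exact, FreeGroup.reduce.sound⟩

end WordProblem

section FreeProductPresentation

open Monoid

variable {a b : ℕ}

/-- Rename the generators occurring in a word. -/
def Word.relabel (f : Fin a → Fin b) (w : Word a) : Word b :=
  w.map fun x => (f x.1, x.2)

theorem Word.primrec_relabel (f : Fin a → Fin b) : Primrec (Word.relabel f) :=
  Primrec.list_map .id (Primrec.pair ((Primrec.dom_finite f).comp (Primrec.fst.comp Primrec.snd))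
    (Primrec.snd.comp Primrec.snd)).to₂

/-- Keep the letters on which `f` is defined, renaming them along `f`. -/
def Word.restrict (f : Fin a → Option (Fin b)) (w : Word a) : Word b :=
  w.filterMap fun x => (f x.1).map fun i => (i, x.2)

theorem Word.primrec_restrict (f : Fin a → Option (Fin b)) : Primrec (Word.restrict f) := by
  refine Primrec.listFilterMap .id ?_
  refine Primrec.option_map ((Primrec.dom_finite f).comp (Primrec.fst.comp Primrec.snd)) ?_
  exact Primrec.pair Primrec.snd (Primrec.snd.comp (Primrec.snd.comp Primrec.fst))

theorem Word.map_mk_restrict {G : Type*} [Group G] (f : Fin a → Option (Fin b))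
    (φ : FreeGroup (Fin a) →* G) (ψ : FreeGroup (Fin b) →* G)
    (h : ∀ i, φ (.of i) = (f i).elim 1 fun j => ψ (.of j)) (w : Word a) :
    φ (FreeGroup.mk w) = ψ (FreeGroup.mk (w.restrict f)) := by
  induction w with
  | nil => exact (map_one φ).trans (map_one ψ).symm
  | cons x w ih =>
    obtain ⟨i, c⟩ := x
    have h1 : φ (FreeGroup.mk [(i, c)]) = (f i).elim 1 fun j => ψ (FreeGroup.mk [(j, c)]) := by
      cases c
      · have h2 : FreeGroup.mk [(i, false)] = (FreeGroup.of i)⁻¹ := rfl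
        rw [h2, map_inv, h]
        cases f i with
        | none => exact inv_one
        | some j => exact (map_inv ψ (FreeGroup.of j)).symm
      · exact h i
    rw [← List.singleton_append, ← FreeGroup.mul_mk, map_mul, ih, h1, Word.restrict, Word.restrict,
      List.singleton_append, List.filterMap_cons]
    cases f i with
    | none => exact one_mul _
    | some j => exact (map_mul ψ _ _).symm

/-- The presentation of the free product of two presented groups. -/
def FinPres.coprod (P Q : FinPres) : FinPres :=
  ⟨P.1 + Q.1, P.2.map (Word.relabel (Fin.castAdd Q.1)) ++ Q.2.map (Word.relabel (Fin.natAdd P.1))⟩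

namespace FinPres

variable (P Q : FinPres)

theorem map_coprod_rels_eq_one {G : Type*} [Group G] (φ : FreeGroup (Fin (P.1 + Q.1)) →* G) :
    (∀ x ∈ (P.coprod Q).rels, φ x = 1) ↔
      (∀ x ∈ P.rels, φ (FreeGroup.map (Fin.castAdd Q.1) x) = 1) ∧
        ∀ x ∈ Q.rels, φ (FreeGroup.map (Fin.natAdd P.1) x) = 1 := by
  have h1 := map_rels_eq_one (R := P.2) (φ.comp (FreeGroup.map (Fin.castAdd Q.1)))
  have h2 := map_rels_eq_one (R := Q.2) (φ.comp (FreeGroup.map (Fin.natAdd P.1)))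
  refine (map_rels_eq_one φ).trans ((Iff.trans ?_ (h1.and h2).symm))
  simp [Word.relabel, or_imp, forall_and]

/-- The inclusion of the left factor into the free product. -/
def coprodInl : P.Grp →* (P.coprod Q).Grp :=
  PresentedGroup.toGroup (f := fun i => (P.coprod Q).proj (.of (Fin.castAdd Q.1 i))) <| by
    have h1 := ((map_coprod_rels_eq_one P Q (P.coprod Q).proj).1 fun _ hx =>
      PresentedGroup.one_of_mem hx).1
    intro r hr
    rw [← h1 r hr]
    exact DFunLike.congr_fun (FreeGroup.ext_hom _
      ((P.coprod Q).proj.comp (FreeGroup.map (Fin.castAdd Q.1))) fun _ => FreeGroup.lift_apply_of) r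

/-- The inclusion of the right factor into the free product. -/
def coprodInr : Q.Grp →* (P.coprod Q).Grp :=
  PresentedGroup.toGroup (f := fun i => (P.coprod Q).proj (.of (Fin.natAdd P.1 i))) <| by
    have h1 := ((map_coprod_rels_eq_one P Q (P.coprod Q).proj).1 fun _ hx =>
      PresentedGroup.one_of_mem hx).2
    intro r hr
    rw [← h1 r hr]
    exact DFunLike.congr_fun (FreeGroup.ext_hom _
      ((P.coprod Q).proj.comp (FreeGroup.map (Fin.natAdd P.1))) fun _ => FreeGroup.lift_apply_of) r

/-- The images of the generators of the presented free product in the free product. -/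
def coprodGen : Fin (P.1 + Q.1) → Coprod P.Grp Q.Grp :=
  Fin.addCases (fun i => Coprod.inl (P.proj (.of i))) fun i => Coprod.inr (Q.proj (.of i))

theorem lift_coprodGen_map_castAdd (x : FreeGroup (Fin P.1)) :
    FreeGroup.lift (coprodGen P Q) (FreeGroup.map (Fin.castAdd Q.1) x) = Coprod.inl (P.proj x) := by
  suffices h : (FreeGroup.lift (coprodGen P Q)).comp (FreeGroup.map (Fin.castAdd Q.1)) =
      (Coprod.inl : P.Grp →* Coprod P.Grp Q.Grp).comp P.proj from DFunLike.congr_fun h x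
  exact FreeGroup.ext_hom _ _ fun i => by simp [coprodGen]

theorem lift_coprodGen_map_natAdd (x : FreeGroup (Fin Q.1)) :
    FreeGroup.lift (coprodGen P Q) (FreeGroup.map (Fin.natAdd P.1) x) = Coprod.inr (Q.proj x) := by
  suffices h : (FreeGroup.lift (coprodGen P Q)).comp (FreeGroup.map (Fin.natAdd P.1)) =
      (Coprod.inr : Q.Grp →* Coprod P.Grp Q.Grp).comp Q.proj from DFunLike.congr_fun h x
  exact FreeGroup.ext_hom _ _ fun i => by simp [coprodGen]

/-- The comparison of the presented free product with the free product of presented groups. -/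
def toCoprod : (P.coprod Q).Grp →* Coprod P.Grp Q.Grp :=
  PresentedGroup.toGroup (f := coprodGen P Q) <| by
    refine (map_coprod_rels_eq_one P Q _).2 ⟨fun x hx => ?_, fun x hx => ?_⟩
    · rw [lift_coprodGen_map_castAdd, proj, PresentedGroup.one_of_mem hx, map_one]
    · rw [lift_coprodGen_map_natAdd, proj, PresentedGroup.one_of_mem hx, map_one]

theorem toCoprod_proj_castAdd (i : Fin P.1) :
    toCoprod P Q ((P.coprod Q).proj (.of (Fin.castAdd Q.1 i))) = Coprod.inl (P.proj (.of i)) :=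
  (PresentedGroup.toGroup.of _).trans (Fin.addCases_left i)

theorem toCoprod_proj_natAdd (i : Fin Q.1) :
    toCoprod P Q ((P.coprod Q).proj (.of (Fin.natAdd P.1 i))) = Coprod.inr (Q.proj (.of i)) :=
  (PresentedGroup.toGroup.of _).trans (Fin.addCases_right i)

theorem coprodInl_proj (i : Fin P.1) :
    coprodInl P Q (P.proj (.of i)) = (P.coprod Q).proj (.of (Fin.castAdd Q.1 i)) :=
  PresentedGroup.toGroup.of _

theorem coprodInr_proj (i : Fin Q.1) :
    coprodInr P Q (Q.proj (.of i)) = (P.coprod Q).proj (.of (Fin.natAdd P.1 i)) :=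
  PresentedGroup.toGroup.of _

theorem lift_toCoprod (z : (P.coprod Q).Grp) :
    Coprod.lift (coprodInl P Q) (coprodInr P Q) (toCoprod P Q z) = z := by
  suffices h : ((Coprod.lift (coprodInl P Q) (coprodInr P Q)).comp (toCoprod P Q)) =
      MonoidHom.id _ from DFunLike.congr_fun h z
  refine PresentedGroup.ext fun i => ?_
  change Coprod.lift (coprodInl P Q) (coprodInr P Q)
    (toCoprod P Q ((P.coprod Q).proj (.of i))) = (P.coprod Q).proj (.of i)
  refine Fin.addCases (fun j => ?_) (fun j => ?_) i
  · rw [toCoprod_proj_castAdd, Coprod.lift_apply_inl, coprodInl_proj]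
  · rw [toCoprod_proj_natAdd, Coprod.lift_apply_inr, coprodInr_proj]

/-- The retraction of the free product onto the left factor. -/
def coprodFst : (P.coprod Q).Grp →* P.Grp := Coprod.fst.comp (toCoprod P Q)

/-- The retraction of the free product onto the right factor. -/
def coprodSnd : (P.coprod Q).Grp →* Q.Grp := Coprod.snd.comp (toCoprod P Q)

theorem coprodFst_coprodInl (x : P.Grp) : coprodFst P Q (coprodInl P Q x) = x := by
  suffices h : (coprodFst P Q).comp (coprodInl P Q) = MonoidHom.id _ from DFunLike.congr_fun h x
  refine PresentedGroup.ext fun i => ?_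
  change Coprod.fst (toCoprod P Q (coprodInl P Q (P.proj (.of i)))) = P.proj (.of i)
  rw [coprodInl_proj, toCoprod_proj_castAdd, Coprod.fst_apply_inl]

theorem coprodSnd_coprodInr (x : Q.Grp) : coprodSnd P Q (coprodInr P Q x) = x := by
  suffices h : (coprodSnd P Q).comp (coprodInr P Q) = MonoidHom.id _ from DFunLike.congr_fun h x
  refine PresentedGroup.ext fun i => ?_
  change Coprod.snd (toCoprod P Q (coprodInr P Q (Q.proj (.of i)))) = Q.proj (.of i)
  rw [coprodInr_proj, toCoprod_proj_natAdd, Coprod.snd_apply_inr]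

theorem coprodFst_eq_one_or_coprodSnd_eq_one {z : (P.coprod Q).Grp} (hz : IsOfFinOrder z) :
    coprodFst P Q z = 1 ∨ coprodSnd P Q z = 1 :=
  Coprod.fst_eq_one_or_snd_eq_one ((toCoprod P Q).isOfFinOrder hz)

theorem eq_one_of_coprodFst_eq_one (hQ : ∀ y : Q.Grp, y = 1) {z : (P.coprod Q).Grp}
    (hz : coprodFst P Q z = 1) : z = 1 := by
  have h1 : Coprod.inl.comp Coprod.fst = MonoidHom.id (Coprod P.Grp Q.Grp) := by
    refine Coprod.hom_ext (MonoidHom.ext fun x => ?_) (MonoidHom.ext fun x => ?_)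
    · simp
    · simp [hQ x]
  rw [← lift_toCoprod P Q z, ← MonoidHom.id_apply _ (toCoprod P Q z), ← h1]
  change Coprod.lift _ _ (Coprod.inl (coprodFst P Q z)) = 1
  simp [hz]

theorem eq_one_of_coprodSnd_eq_one (hP : ∀ x : P.Grp, x = 1) {z : (P.coprod Q).Grp}
    (hz : coprodSnd P Q z = 1) : z = 1 := by
  have h1 : Coprod.inr.comp Coprod.snd = MonoidHom.id (Coprod P.Grp Q.Grp) := by
    refine Coprod.hom_ext (MonoidHom.ext fun x => ?_) (MonoidHom.ext fun x => ?_)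
    · simp [hP x]
    · simp
  rw [← lift_toCoprod P Q z, ← MonoidHom.id_apply _ (toCoprod P Q z), ← h1]
  change Coprod.lift _ _ (Coprod.inr (coprodSnd P Q z)) = 1
  simp [hz]

/-- The partial inverse of `Fin.castAdd`. -/
def _root_.Fin.leftPart (a b : ℕ) : Fin (a + b) → Option (Fin a) :=
  Fin.addCases some fun _ => none

/-- The partial inverse of `Fin.natAdd`. -/
def _root_.Fin.rightPart (a b : ℕ) : Fin (a + b) → Option (Fin b) :=
  Fin.addCases (fun _ => none) some

theorem coprodFst_proj_mk (w : Word (P.1 + Q.1)) : coprodFst P Q ((P.coprod Q).proj (.mk w)) =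
    P.proj (.mk (w.restrict (Fin.leftPart P.1 Q.1))) := by
  refine Word.map_mk_restrict _ ((coprodFst P Q).comp (P.coprod Q).proj) _ (fun i => ?_) w
  change Coprod.fst (toCoprod P Q ((P.coprod Q).proj (.of i))) = _
  refine Fin.addCases (fun j => ?_) (fun j => ?_) i
  · rw [toCoprod_proj_castAdd, Coprod.fst_apply_inl, Fin.leftPart, Fin.addCases_left]
    rfl
  · rw [toCoprod_proj_natAdd, Coprod.fst_apply_inr, Fin.leftPart, Fin.addCases_right]
    rfl

theorem coprodSnd_proj_mk (w : Word (P.1 + Q.1)) : coprodSnd P Q ((P.coprod Q).proj (.mk w)) =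
    Q.proj (.mk (w.restrict (Fin.rightPart P.1 Q.1))) := by
  refine Word.map_mk_restrict _ ((coprodSnd P Q).comp (P.coprod Q).proj) _ (fun i => ?_) w
  change Coprod.snd (toCoprod P Q ((P.coprod Q).proj (.of i))) = _
  refine Fin.addCases (fun j => ?_) (fun j => ?_) i
  · rw [toCoprod_proj_castAdd, Coprod.snd_apply_inl, Fin.rightPart, Fin.addCases_left]
    rfl
  · rw [toCoprod_proj_natAdd, Coprod.snd_apply_inr, Fin.rightPart, Fin.addCases_right]
    rfl

end FinPres

end FreeProductPresentation

section Diagonalization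

open Encodable

theorem REPred.comp {α β : Type*} [Primcodable α] [Primcodable β] {p : β → Prop} (hp : REPred p)
    {f : α → β} (hf : Computable f) : REPred fun a => p (f a) :=
  Partrec.comp hp hf

theorem REPred.exists_merge {α σ : Type*} [Primcodable α] [Primcodable σ] {p q : α → Prop}
    (hp : REPred p) (hq : REPred q) (s t : σ) :
    ∃ k : α →. σ, Partrec k ∧ ∀ a, (∀ x ∈ k a, p a ∧ x = s ∨ q a ∧ x = t) ∧
      ((k a).Dom ↔ p a ∨ q a) := by
  have h1 : ∀ {r : α → Prop} (_ : REPred r) (u : σ),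
      Partrec fun a => (Part.assert (r a) fun _ => Part.some ()).map fun _ => u :=
    fun hr u => Partrec.map hr (Computable.const u).to₂
  obtain ⟨k, hk, h⟩ := Partrec.merge' (h1 hp s) (h1 hq t)
  refine ⟨k, hk, fun a => ⟨fun x hx => ?_, (h a).2.trans ?_⟩⟩
  · simpa [eq_comm] using (h a).1 x hx
  · simp [Part.assert]

theorem rePred_mem_eval (i : ℕ) :
    REPred fun n => i ∈ (Denumerable.ofNat Nat.Partrec.Code n).eval n := by
  have h1 : Partrec fun n : ℕ => (Denumerable.ofNat Nat.Partrec.Code n).eval n :=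
    Nat.Partrec.Code.eval_part.comp (Computable.ofNat _) Computable.id
  have h2 : Computable fun z : ℕ × ℕ => if z.2 = i then some () else none :=
    (Primrec.ite (Primrec.eq.comp Primrec.snd (.const i)) (.const _) (.const _)).to_comp
  refine (h1.bind h2.ofOption.to₂).dom_re.of_eq fun n => ?_
  simp only [Part.dom_iff_mem, Part.mem_bind_iff, Part.mem_ofOption, Option.mem_def]
  constructor
  · rintro ⟨_, j, hj, hij⟩
    by_cases h : j = i
    · exact h ▸ hj
    · simp [h] at hij
  · exact fun h => ⟨(), i, h, if_pos rfl⟩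

theorem primrec_encode_finPres {m : ℕ} {R : ℕ → List (Word m)} (hR : Primrec R) (k : ℕ) :
    Primrec fun n => encode ((⟨m, R n⟩ : FinPres), k) := by
  have h1 : Primrec fun n => Nat.pair (Nat.pair m (encode (R n))) k :=
    Primrec₂.natPair.comp (Primrec₂.natPair.comp (.const m) (Primrec.encode.comp hR)) (.const k)
  exact h1

/-- The word with a given code. -/
def decodeWord (m c : ℕ) : Word m := (decode c).getD []

theorem decodeWord_encode {m : ℕ} (w : Word m) : decodeWord m (encode w) = w := by
  have h : (decode (encode w) : Option (Word m)) = some w := encodek w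
  rw [decodeWord, h, Option.getD_some]

theorem primrec_decodeWord (m : ℕ) : Primrec (decodeWord m) :=
  Primrec.option_getD.comp Primrec.decode (.const [])

theorem rePred_proj_restrict {m n : ℕ} {R : ℕ → List (Word m)} (hR : Primrec R)
    (f : Fin n → Option (Fin m)) : REPred fun z : ℕ × ℕ =>
      FinPres.proj ⟨m, R z.1⟩ (FreeGroup.mk ((decodeWord n z.2).restrict f)) = 1 := by
  have h : Primrec fun z : ℕ × ℕ => (R z.1, (decodeWord n z.2).restrict f) :=
    Primrec.pair (hR.comp Primrec.fst)
      ((Word.primrec_restrict f).comp ((primrec_decodeWord n).comp Primrec.snd))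
  have h2 := rePred_proj_eq_one.comp h.to_comp
  dsimp only at h2
  exact h2

theorem exists_orderOf_coprod_eq {P Q : FinPres} {n : ℕ}
    (h : (∃ x : P.Grp, orderOf x = n) ∨ ∃ y : Q.Grp, orderOf y = n) :
    ∃ z : (P.coprod Q).Grp, orderOf z = n := by
  rcases h with ⟨x, rfl⟩ | ⟨y, rfl⟩
  · exact ⟨_, orderOf_injective (P.coprodInl Q)
      (Function.LeftInverse.injective (P.coprodFst_coprodInl Q)) x⟩
  · exact ⟨_, orderOf_injective (P.coprodInr Q)
      (Function.LeftInverse.injective (P.coprodSnd_coprodInr Q)) y⟩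

end Diagonalization

/-- Lemma 6.6 (Chiodo): there is no algorithm that, on input of a finite presentation
of a group with torsion together with some `n ≥ 2` which is the order of one of its
elements, halts and outputs a word representing a nontrivial torsion element
(of any order) of the presented group. -/
theorem no_algorithm_torsion_word :
    ¬ ∃ g : ℕ →. ℕ, Nat.Partrec g ∧
      ∀ (P : FinPres) (n : ℕ),
        (∃ x : P.Grp, x ≠ 1 ∧ orderOf x ≠ 0) →
        2 ≤ n → (∃ x : P.Grp, orderOf x = n) →
        ∃ w : Word P.1,
          Encodable.encode w ∈ g (Encodable.encode (P, n)) ∧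
          P.proj (FreeGroup.mk w) ≠ 1 ∧ orderOf (P.proj (FreeGroup.mk w)) ≠ 0 := by
  rintro ⟨g, hg, h⟩
  obtain ⟨a, RA, hRA, hA⟩ := exists_finPres_family (rePred_mem_eval 0)
  obtain ⟨b, RB, hRB, hB⟩ := exists_finPres_family (rePred_mem_eval 1)
  let A : ℕ → FinPres := fun n => ⟨a, RA n⟩
  let B : ℕ → FinPres := fun n => ⟨b, RB n⟩
  let P : ℕ → FinPres := fun n => (A n).coprod (B n)
  let R : ℕ → List (Word (a + b)) := fun n =>
    (RA n).map (Word.relabel (Fin.castAdd b)) ++ (RB n).map (Word.relabel (Fin.natAdd a))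
  have hR : Primrec R := Primrec.list_append.comp
    (Primrec.list_map hRA ((Word.primrec_relabel _).comp Primrec.snd).to₂)
    (Primrec.list_map hRB ((Word.primrec_relabel _).comp Primrec.snd).to₂)
  have hPcode : Primrec fun n => Encodable.encode (P n, 2) := primrec_encode_finPres hR 2
  obtain ⟨k, hk, hkv⟩ := (rePred_proj_restrict hRA (Fin.leftPart a b)).exists_merge
    (rePred_proj_restrict hRB (Fin.rightPart a b)) 1 0
  have hF : Nat.Partrec fun n => (g (Encodable.encode (P n, 2))).bind fun c => k (n, c) :=
    Partrec.nat_iff.1 (((Partrec.nat_iff.2 hg).comp hPcode.to_comp).bind hk.to₂)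
  obtain ⟨c, hc⟩ := Nat.Partrec.Code.exists_code.1 hF
  obtain ⟨e, rfl⟩ : ∃ e, c = Denumerable.ofNat Nat.Partrec.Code e :=
    ⟨Encodable.encode c, (Denumerable.ofNat_encode c).symm⟩
  have heval : (Denumerable.ofNat Nat.Partrec.Code e).eval e =
      (g (Encodable.encode (P e, 2))).bind fun c => k (e, c) := congrFun hc e
  have hor : 0 ∉ (Denumerable.ofNat Nat.Partrec.Code e).eval e ∨
      1 ∉ (Denumerable.ofNat Nat.Partrec.Code e).eval e := by
    by_contra! h1
    exact zero_ne_one (Part.mem_unique h1.1 h1.2)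
  obtain ⟨z, hz⟩ : ∃ z : (P e).Grp, orderOf z = 2 :=
    exists_orderOf_coprod_eq (hor.imp (hA e).2 (hB e).2)
  obtain ⟨w, hw, hw1, hw2⟩ : ∃ w : Word (a + b),
      Encodable.encode w ∈ g (Encodable.encode (P e, 2)) ∧
      (P e).proj (.mk w) ≠ 1 ∧ orderOf ((P e).proj (.mk w)) ≠ 0 :=
    h (P e) 2 ⟨z, by rintro rfl; simp at hz, by simp [hz]⟩ le_rfl ⟨z, hz⟩
  have hkd : (k (e, Encodable.encode w)).Dom := by
    refine (hkv _).2.2 ?_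
    dsimp only
    rw [decodeWord_encode]
    have h1 := FinPres.coprodFst_eq_one_or_coprodSnd_eq_one (A e) (B e) (z := (P e).proj (.mk w))
      (orderOf_pos_iff.1 (Nat.pos_of_ne_zero hw2))
    rwa [FinPres.coprodFst_proj_mk, FinPres.coprodSnd_proj_mk] at h1
  obtain ⟨v, hv⟩ := Part.dom_iff_mem.1 hkd
  have hve : v ∈ (Denumerable.ofNat Nat.Partrec.Code e).eval e := by
    rw [heval]
    exact Part.mem_bind hw hv
  rcases (hkv _).1 v hv with ⟨h1, rfl⟩ | ⟨h1, rfl⟩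
  · dsimp only at h1
    rw [decodeWord_encode] at h1
    exact hw1 (FinPres.eq_one_of_coprodFst_eq_one (A e) (B e) ((hB e).1 hve)
      ((FinPres.coprodFst_proj_mk (A e) (B e) w).trans h1))
  · dsimp only at h1
    rw [decodeWord_encode] at h1
    exact hw1 (FinPres.eq_one_of_coprodSnd_eq_one (A e) (B e) ((hA e).1 hve)
      ((FinPres.coprodSnd_proj_mk (A e) (B e) w).trans h1))
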